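/- Let C be a mild contour in a ray category P which is a dumb-bell, with points x, y, loops λ at x and ρ at y and arrow μ : x → y. Then μ and ρ are the only arrows of P ending at y. -/

import Mathlib

set_option autoImplicit false

/-- A ray category (Bautista–Gabriel–Roiter–Salmerón).  The fields `pipow x`
record the powers of the generator `π(x)` of the radical of `P(x,x)`. -/
structure RayCategory : Type 1 where
  Obj : Type
  Hom : Obj → Obj → Type
  id : ∀ x : Obj, Hom x x
  comp : ∀ {x y z : Obj}, Hom y z → Hom x y → Hom x z
  zero : ∀ x y : Obj, Hom x y
  comp_id : ∀ {x y : Obj} (f : Hom x y), comp f (id x) = f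
  id_comp : ∀ {x y : Obj} (f : Hom x y), comp (id y) f = f
  assoc : ∀ {x y z w : Obj} (h : Hom z w) (g : Hom y z) (f : Hom x y),
      comp (comp h g) f = comp h (comp g f)
  /-- axiom b : zero morphisms -/
  zero_comp : ∀ {x y z : Obj} (f : Hom x y), comp (zero y z) f = zero x z
  comp_zero : ∀ {x y z : Obj} (f : Hom y z), comp f (zero x y) = zero x z
  /-- axiom a : the objects are pairwise non-isomorphic -/
  no_iso : ∀ {x y : Obj} (f : Hom x y) (g : Hom y x),
      comp g f = id x → comp f g = id y → x = y
  /-- axiom c : local finiteness -/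
  finite_target : ∀ x : Obj, {y : Obj | ∃ f : Hom x y, f ≠ zero x y}.Finite
  finite_source : ∀ x : Obj, {y : Obj | ∃ f : Hom y x, f ≠ zero y x}.Finite
  /-- the powers of the generator `π(x)` of `P(x,x)`; `pipow x 1 = π(x)`. -/
  pipow : ∀ x : Obj, ℕ → Hom x x
  pipow_zero : ∀ x, pipow x 0 = id x
  pipow_succ : ∀ x n, pipow x (n + 1) = comp (pipow x 1) (pipow x n)
  nilp : Obj → ℕ
  nilp_pos : ∀ x, 1 ≤ nilp x
  /-- axiom d : `P(x,x) = {id, σ, …, σ^{n-1} ≠ 0 = σ^n}` -/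
  endo_cyclic : ∀ (x : Obj) (f : Hom x x), ∃ i : ℕ, f = pipow x i
  pipow_nilp : ∀ x, pipow x (nilp x) = zero x x
  pipow_nilp_ne : ∀ x, pipow x (nilp x - 1) ≠ zero x x
  /-- axiom e : `P(x,y)` is cyclic under the action of `P(x,x)` or of `P(y,y)` -/
  hom_cyclic : ∀ x y : Obj, ∃ g : Hom x y,
      (∀ f : Hom x y, ∃ i : ℕ, f = comp (pipow y i) g) ∨
      (∀ f : Hom x y, ∃ i : ℕ, f = comp g (pipow x i))
  /-- axiom f : cancellation -/
  cancel : ∀ {x y z w : Obj} (kappa : Hom x y) (mu nu : Hom y z) (lam : Hom z w),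
      comp lam (comp mu kappa) = comp lam (comp nu kappa) →
      comp lam (comp mu kappa) ≠ zero x w → mu = nu

namespace RayCategory

variable (P : RayCategory)

/-- the generator of the radical of `P(x,x)` -/
def pi (x : P.Obj) : P.Hom x x := P.pipow x 1

/-- powers of an endomorphism -/
def pow {x : P.Obj} (f : P.Hom x x) : ℕ → P.Hom x x
  | 0 => P.id x
  | n + 1 => P.comp f (pow f n)

/-- `f` is an identity morphism -/
def IsId {x y : P.Obj} (f : P.Hom x y) : Prop := ∃ _ : x = y, HEq f (P.id x)

/-- irreducible morphisms (= arrows of the quiver of `P`): nonzero morphisms which are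
not identities and cannot be written as a product of two non-identity morphisms -/
def IsIrreducible {x y : P.Obj} (f : P.Hom x y) : Prop :=
  f ≠ P.zero x y ∧ ¬ P.IsId f ∧
    ∀ (z : P.Obj) (g : P.Hom z y) (h : P.Hom x z), f = P.comp g h → P.IsId g ∨ P.IsId h

/-- irreducibility inside the full subcategory supported by `S` -/
def IsIrreducibleOn (S : Set P.Obj) {x y : P.Obj} (f : P.Hom x y) : Prop :=
  f ≠ P.zero x y ∧ ¬ P.IsId f ∧
    ∀ z ∈ S, ∀ (g : P.Hom z y) (h : P.Hom x z), f = P.comp g h → P.IsId g ∨ P.IsId h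

/-- the sub-bimodule `P(y,y) μ P(x,x)` of `P(x,y)` generated by `μ` -/
def Bimod {x y : P.Obj} (mu : P.Hom x y) : Set (P.Hom x y) :=
  {f | ∃ i j : ℕ, f = P.comp (P.pipow y i) (P.comp mu (P.pipow x j))}

/-- `μ` is transit : the sub-bimodule generated by `μ` is cyclic over `P(y,y)` -/
def IsTransit {x y : P.Obj} (mu : P.Hom x y) : Prop :=
  mu ≠ P.zero x y ∧
    ∃ g ∈ P.Bimod mu, ∀ f ∈ P.Bimod mu, ∃ i : ℕ, f = P.comp (P.pipow y i) g

/-- `μ` is cotransit : the sub-bimodule generated by `μ` is cyclic over `P(x,x)` -/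
def IsCotransit {x y : P.Obj} (mu : P.Hom x y) : Prop :=
  mu ≠ P.zero x y ∧
    ∃ g ∈ P.Bimod mu, ∀ f ∈ P.Bimod mu, ∃ j : ℕ, f = P.comp g (P.pipow x j)

/-- `μ` is deep : `π(y)μ = 0 = μπ(x)` -/
def IsDeep {x y : P.Obj} (mu : P.Hom x y) : Prop :=
  mu ≠ P.zero x y ∧ P.comp (P.pi y) mu = P.zero x y ∧ P.comp mu (P.pi x) = P.zero x y

/-- transport of a morphism along equalities of objects -/
def castHom {a b c d : P.Obj} (h1 : a = c) (h2 : b = d) (f : P.Hom a b) : P.Hom c d :=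
  cast (by rw [h1, h2]) f

/-- the composite `a_{i+j-1} ⋯ a_{i+1} a_i : x_i → x_{i+j}` of a chain of morphisms -/
def chain (x : ℕ → P.Obj) (a : ∀ i : ℕ, P.Hom (x i) (x (i + 1))) (i : ℕ) :
    ∀ j : ℕ, P.Hom (x i) (x (i + j))
  | 0 => P.id (x i)
  | j + 1 => P.comp (a (i + j)) (chain x a i j)

end RayCategory

/-- Paths in the quiver `Q_P` of a ray category `P` (the arrow `f` of `cons f hf p`
is the *last* arrow of the path). -/
inductive RPath (P : RayCategory) : P.Obj → P.Obj → Type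
  | nil (x : P.Obj) : RPath P x x
  | cons {x y z : P.Obj} (f : P.Hom y z) (hf : P.IsIrreducible f) (p : RPath P x y) :
      RPath P x z

namespace RPath

variable {P : RayCategory}

/-- the morphism `v⃗` of `P` obtained by composing the arrows of a path `v` -/
def toHom : ∀ {x y : P.Obj}, RPath P x y → P.Hom x y
  | _, _, .nil x => P.id x
  | _, _, .cons f _ p => P.comp f p.toHom

def length : ∀ {x y : P.Obj}, RPath P x y → ℕ
  | _, _, .nil _ => 0
  | _, _, .cons _ _ p => p.length + 1

/-- the set of points visited by a path -/
def points : ∀ {x y : P.Obj}, RPath P x y → Set P.Obj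
  | _, _, .nil x => {x}
  | _, _, @RPath.cons _ _ _ z _ _ p => insert z p.points

/-- concatenation of paths -/
def append : ∀ {x y z : P.Obj}, RPath P y z → RPath P x y → RPath P x z
  | _, _, _, .nil _, p => p
  | _, _, _, .cons f hf q, p => .cons f hf (q.append p)

/-- the arrow `g` occurs in the path -/
def HasArrow : ∀ {x y : P.Obj}, RPath P x y → ∀ {a b : P.Obj}, P.Hom a b → Prop
  | _, _, .nil _, _, _, _ => False
  | _, _, .cons f _ p, _, _, g => HEq f g ∨ p.HasArrow g

/-- one step of the interlacing relation: `v = p v' q`, `w = p w' q` with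
`v⃗' = w⃗' ≠ 0` and `p`, `q` not both identities -/
def InterlaceStep {x y : P.Obj} (v w : RPath P x y) : Prop :=
  ∃ (a b : P.Obj) (p : RPath P b y) (v' w' : RPath P a b) (q : RPath P x a),
    v = p.append (v'.append q) ∧ w = p.append (w'.append q) ∧
    v'.toHom = w'.toHom ∧ v'.toHom ≠ P.zero a b ∧ ¬ (p.length = 0 ∧ q.length = 0)

/-- two paths are interlaced if they lie in the transitive closure of the relation above -/
def Interlaced {x y : P.Obj} (v w : RPath P x y) : Prop :=
  Relation.TransGen (fun v' w' : RPath P x y => InterlaceStep v' w') v w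

end RPath

/-- a chain of arrows as a path -/
def pchain (P : RayCategory) (x : ℕ → P.Obj) (a : ∀ i : ℕ, P.Hom (x i) (x (i + 1)))
    (ha : ∀ i, P.IsIrreducible (a i)) (i : ℕ) : ∀ j : ℕ, RPath P (x i) (x (i + j))
  | 0 => .nil (x i)
  | j + 1 => .cons (a (i + j)) (ha (i + j)) (pchain P x a ha i j)

/-- A contour `C = {v,w}` of `P` from `x` to `y` : a pair of different, non-interlaced
paths with `v⃗ = w⃗ ≠ 0`. -/
structure Contour (P : RayCategory) (x y : P.Obj) : Type where
  v : RPath P x y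
  w : RPath P x y
  ne : v ≠ w
  hom_eq : v.toHom = w.toHom
  nz : v.toHom ≠ P.zero x y
  nint : ¬ RPath.Interlaced v w
/-- A module over the linearization `k(D/I)` of the quotient by the ideal generated by the
morphisms in `I` of the full subcategory of `P` supported by `D`:
a `k`-linear functor defined on the morphisms between points of `D`, vanishing on `I`.
For `D = Set.univ` and `I = fun _ _ _ => False` this is exactly a `k(P)`-module. -/
structure RMod (P : RayCategory) (k : Type) [Field k] (D : Set P.Obj)
    (I : ∀ a b : P.Obj, P.Hom a b → Prop) where
  M : P.Obj → Type
  [acg : ∀ x, AddCommGroup (M x)]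
  [mod : ∀ x, Module k (M x)]
  act : ∀ {x y : P.Obj}, P.Hom x y → (M x →ₗ[k] M y)
  act_id : ∀ x ∈ D, act (P.id x) = LinearMap.id
  act_comp : ∀ {x y z : P.Obj}, x ∈ D → y ∈ D → z ∈ D →
      ∀ (g : P.Hom y z) (f : P.Hom x y), act (P.comp g f) = (act g).comp (act f)
  act_zero : ∀ {x y : P.Obj}, x ∈ D → y ∈ D → act (P.zero x y) = 0
  supp : ∀ x : P.Obj, x ∉ D → ∀ m : M x, m = 0
  killed : ∀ {a b : P.Obj} (f : P.Hom a b), I a b f → act f = 0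

attribute [instance] RMod.acg RMod.mod

/-- morphisms of modules -/
structure RModHom {P : RayCategory} {k : Type} [Field k] {D : Set P.Obj}
    {I : ∀ a b : P.Obj, P.Hom a b → Prop} (M N : RMod P k D I) where
  app : ∀ x : P.Obj, M.M x →ₗ[k] N.M x
  natural : ∀ {x y : P.Obj} (f : P.Hom x y), (N.act f).comp (app x) = (app y).comp (M.act f)

/-- isomorphism of modules -/
def RModIso {P : RayCategory} {k : Type} [Field k] {D : Set P.Obj}
    {I : ∀ a b : P.Obj, P.Hom a b → Prop} (M N : RMod P k D I) : Prop :=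
  ∃ φ : RModHom M N, ∀ x, Function.Bijective (φ.app x)

namespace RMod

variable {P : RayCategory} {k : Type} [Field k] {D : Set P.Obj}
  {I : ∀ a b : P.Obj, P.Hom a b → Prop}

/-- finite-dimensional: the sum of the dimensions of all `M x` is finite -/
def FinDim (M : RMod P k D I) : Prop :=
  (∀ x, FiniteDimensional k (M.M x)) ∧ {x : P.Obj | ∃ m : M.M x, m ≠ 0}.Finite

def Nonzero (M : RMod P k D I) : Prop := ∃ x, ∃ m : M.M x, m ≠ 0

/-- indecomposable: nonzero, and the only idempotent endomorphisms are `0` and `id` -/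
def Indec (M : RMod P k D I) : Prop :=
  M.Nonzero ∧ ∀ e : RModHom M M, (∀ x, (e.app x).comp (e.app x) = e.app x) →
    (∀ x, e.app x = 0) ∨ (∀ x, e.app x = LinearMap.id)

end RMod

/-- the full subcategory supported by `D` of the quotient of `P` by the ideal generated
by `I` is (locally) representation-finite: for any field `k`, every point lies in the
support of only finitely many isomorphism classes of finite-dimensional indecomposables -/
def RepFin (P : RayCategory) (D : Set P.Obj) (I : ∀ a b : P.Obj, P.Hom a b → Prop) : Prop :=
  ∀ (k : Type) [Field k], ∀ x : P.Obj,
    ∃ (ι : Type) (_ : Finite ι) (rep : ι → RMod P k D I),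
      ∀ M : RMod P k D I, M.FinDim → M.Indec → (∃ m : M.M x, m ≠ 0) →
        ∃ i : ι, RModIso (rep i) M

/-- the trivial ideal -/
def RayCategory.noIdeal (P : RayCategory) : ∀ a b : P.Obj, P.Hom a b → Prop :=
  fun _ _ _ => False

/-- `P` is locally representation-finite -/
def LocRepFin (P : RayCategory) : Prop := RepFin P Set.univ P.noIdeal

/-- the ideal of `P` generated by the morphism `μ` -/
def IdealOf (P : RayCategory) {a b : P.Obj} (mu : P.Hom a b) :
    ∀ s t : P.Obj, P.Hom s t → Prop :=
  fun s t f => ∃ (g : P.Hom b t) (h : P.Hom s a), f = P.comp g (P.comp mu h)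

/-- an ideal of a ray category -/
structure RIdeal (P : RayCategory) where
  mem : ∀ a b : P.Obj, P.Hom a b → Prop
  zero_mem : ∀ a b : P.Obj, mem a b (P.zero a b)
  comp_mem_left : ∀ {a b c : P.Obj} (g : P.Hom b c) (f : P.Hom a b),
      mem a b f → mem a c (P.comp g f)
  comp_mem_right : ∀ {a b c : P.Obj} (g : P.Hom b c) (f : P.Hom a b),
      mem b c g → mem a c (P.comp g f)

/-- `P` is minimal representation-infinite: not locally representation-finite, but every
proper quotient (quotient by an ideal containing a nonzero morphism) is locally
representation-finite -/
def MinRepInfinite (P : RayCategory) : Prop :=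
  ¬ LocRepFin P ∧ ∀ J : RIdeal P,
    (∃ (a b : P.Obj) (f : P.Hom a b), f ≠ P.zero a b ∧ J.mem a b f) →
      RepFin P Set.univ J.mem

/-- support of the indecomposable projective module `P_x` over the quotient of `P` by `I` -/
def ProjSupp (P : RayCategory) (I : ∀ a b : P.Obj, P.Hom a b → Prop) (x : P.Obj) :
    Set P.Obj :=
  {y : P.Obj | ∃ f : P.Hom x y, f ≠ P.zero x y ∧ ¬ I x y f}

/-- support of the indecomposable injective module `I_y` over the quotient of `P` by `I` -/
def InjSupp (P : RayCategory) (I : ∀ a b : P.Obj, P.Hom a b → Prop) (y : P.Obj) :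
    Set P.Obj :=
  {z : P.Obj | ∃ f : P.Hom z y, f ≠ P.zero z y ∧ ¬ I z y f}

namespace Contour

variable {P : RayCategory} {x y : P.Obj} (C : Contour P x y)

/-- points of the contour = points of the full subcategory `P(C)` -/
def points : Set P.Obj := C.v.points ∪ C.w.points

/-- the contour is non-deep -/
def NonDeep : Prop := ¬ P.IsDeep C.v.toHom

/-- the ideal generated by `π(y)v⃗`, so that `P' = P/π(y)v⃗` (transit case) -/
def It : ∀ a b : P.Obj, P.Hom a b → Prop := IdealOf P (P.comp (P.pi y) C.v.toHom)

/-- the ideal generated by `v⃗π(x)` (cotransit case) -/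
def Ic : ∀ a b : P.Obj, P.Hom a b → Prop := IdealOf P (P.comp C.v.toHom (P.pi x))

/-- decisive subcategories of `P' = P/π(y)v⃗` for `C` (transit case) -/
def DecisiveT (D : Set P.Obj) : Prop :=
  x ∈ D ∧ y ∈ D ∧ D ⊆ ProjSupp P C.It x ∪ InjSupp P C.It y

/-- decisive subcategories (cotransit case) -/
def DecisiveC (D : Set P.Obj) : Prop :=
  x ∈ D ∧ y ∈ D ∧ D ⊆ ProjSupp P C.Ic x ∪ InjSupp P C.Ic y

/-- mildness in the transit case: `C` is non-deep, `v⃗` is transit, and every decisive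
full subcategory of `P/π(y)v⃗` with at most 4 points is representation-finite -/
def MildTransit : Prop :=
  C.NonDeep ∧ P.IsTransit C.v.toHom ∧
    ∀ D : Set P.Obj, C.DecisiveT D → D.Finite → D.ncard ≤ 4 → RepFin P D C.It

/-- mildness in the cotransit case (dual) -/
def MildCotransit : Prop :=
  C.NonDeep ∧ P.IsCotransit C.v.toHom ∧
    ∀ D : Set P.Obj, C.DecisiveC D → D.Finite → D.ncard ≤ 4 → RepFin P D C.Ic

/-- a mild contour -/
def Mild : Prop := C.MildTransit ∨ C.MildCotransit

/-- equality of contours (with possibly different endpoints), as sets `{v,w}` -/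
def Same {x' y' : P.Obj} (C' : Contour P x' y') : Prop :=
  ∃ (_ : x = x') (_ : y = y'),
    (HEq C.v C'.v ∧ HEq C.w C'.w) ∨ (HEq C.v C'.w ∧ HEq C.w C'.v)

end Contour
/-- the full subcategory on `{x,y}` is a dumb-bell with loops `lam`, `rho`, arrow `mu`
and nilpotency indices `r`, `s` -/
def DumbBellData (P : RayCategory) (x y : P.Obj) (lam : P.Hom x x) (mu : P.Hom x y)
    (rho : P.Hom y y) (r s : ℕ) : Prop :=
  x ≠ y ∧
  P.IsIrreducibleOn {x, y} lam ∧ P.IsIrreducibleOn {x, y} mu ∧ P.IsIrreducibleOn {x, y} rho ∧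
  (∀ a b : P.Obj, a ∈ ({x, y} : Set P.Obj) → b ∈ ({x, y} : Set P.Obj) →
      ∀ f : P.Hom a b, P.IsIrreducibleOn {x, y} f → HEq f lam ∨ HEq f mu ∨ HEq f rho) ∧
  P.comp mu lam = P.comp rho mu ∧
  P.pow lam r = P.zero x x ∧ P.pow rho s = P.zero y y ∧
  P.pow lam (r - 1) ≠ P.zero x x ∧ P.pow rho (s - 1) ≠ P.zero y y ∧
  min r s = 3 ∧ max r s ≤ 5 ∧
  (∀ f : P.Hom x x, ∃ i : ℕ, f = P.pow lam i) ∧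
  (∀ f : P.Hom y y, ∃ i : ℕ, f = P.pow rho i) ∧
  (∀ f : P.Hom x y, f = P.zero x y ∨ ∃ i : ℕ, f = P.comp mu (P.pow lam i)) ∧
  (∀ i : ℕ, i < min r s → P.comp mu (P.pow lam i) ≠ P.zero x y) ∧
  (∀ f : P.Hom y x, f = P.zero y x)

/-- the full subcategory supported by `S` is a dumb-bell -/
def IsDumbBellOn (P : RayCategory) (S : Set P.Obj) : Prop :=
  ∃ (x y : P.Obj) (lam : P.Hom x x) (mu : P.Hom x y) (rho : P.Hom y y) (r s : ℕ),
    DumbBellData P x y lam mu rho r s ∧ S = {x, y}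

/-- the full subcategory on the points `x 0, …, x (n-1)` is a penny-farthing with arrows
`a i` (`a i = α_{i+1} : x_i → x_{i+1}`, indices mod `n`) and loop `rho` at `x 0` -/
def PennyData (P : RayCategory) (n : ℕ) (x : ℕ → P.Obj)
    (a : ∀ i : ℕ, P.Hom (x i) (x (i + 1))) (rho : P.Hom (x 0) (x 0)) : Prop :=
  1 ≤ n ∧
  (∀ i, x (i + n) = x i) ∧ (∀ i, HEq (a (i + n)) (a i)) ∧
  (∀ i j, i < n → j < n → x i = x j → i = j) ∧
  (∀ i, P.IsIrreducibleOn (Set.range x) (a i)) ∧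
  P.IsIrreducibleOn (Set.range x) rho ∧
  (∀ b c : P.Obj, b ∈ Set.range x → c ∈ Set.range x → ∀ f : P.Hom b c,
      P.IsIrreducibleOn (Set.range x) f → HEq f rho ∨ ∃ i, i < n ∧ HEq f (a i)) ∧
  -- relation α₁αₙ = 0
  P.chain x a (n - 1) 2 = P.zero (x (n - 1)) (x (n - 1 + 2)) ∧
  -- relation αₙ⋯α₁ = ρ²
  (∀ h : x (0 + n) = x 0, P.castHom rfl h (P.chain x a 0 n) = P.comp rho rho) ∧
  -- relations 0 = α_{e i}⋯α₁ ρ αₙ⋯α_{i+1} for a non-decreasing e : {1,…,n-1} → {1,…,n}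
  ∃ e : ℕ → ℕ,
    (∀ i, 1 ≤ i → i ≤ n - 1 → 1 ≤ e i ∧ e i ≤ n) ∧
    (∀ i j, 1 ≤ i → i ≤ j → j ≤ n - 1 → e i ≤ e j) ∧
    (∀ i, 1 ≤ i → i ≤ n - 1 → ∀ h : x (i + (n - i)) = x 0,
      P.comp (P.chain x a 0 (e i))
        (P.comp rho (P.castHom rfl h (P.chain x a i (n - i)))) =
      P.zero (x i) (x (0 + e i)))

/-- the full subcategory supported by `S` is a penny-farthing -/
def IsPennyFarthingOn (P : RayCategory) (S : Set P.Obj) : Prop :=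
  ∃ (n : ℕ) (x : ℕ → P.Obj) (a : ∀ i : ℕ, P.Hom (x i) (x (i + 1))) (rho : P.Hom (x 0) (x 0)),
    PennyData P n x a rho ∧ S = Set.range x

/-- the full subcategory on `{x,z,t,y}` is a diamond with arrows
`gam : x → z`, `lam : z → x`, `del : x → t`, `bet : t → y`, `alp : z → y`, `kap : y → z` -/
def DiamondData (P : RayCategory) (x z t y : P.Obj) (gam : P.Hom x z) (lam : P.Hom z x)
    (del : P.Hom x t) (bet : P.Hom t y) (alp : P.Hom z y) (kap : P.Hom y z) : Prop :=
  (x ≠ z ∧ x ≠ t ∧ x ≠ y ∧ z ≠ t ∧ z ≠ y ∧ t ≠ y) ∧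
  P.IsIrreducibleOn {x, z, t, y} gam ∧ P.IsIrreducibleOn {x, z, t, y} lam ∧
  P.IsIrreducibleOn {x, z, t, y} del ∧ P.IsIrreducibleOn {x, z, t, y} bet ∧
  P.IsIrreducibleOn {x, z, t, y} alp ∧ P.IsIrreducibleOn {x, z, t, y} kap ∧
  (∀ a b : P.Obj, a ∈ ({x, z, t, y} : Set P.Obj) → b ∈ ({x, z, t, y} : Set P.Obj) →
      ∀ f : P.Hom a b, P.IsIrreducibleOn {x, z, t, y} f →
        HEq f gam ∨ HEq f lam ∨ HEq f del ∨ HEq f bet ∨ HEq f alp ∨ HEq f kap) ∧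
  P.comp alp gam = P.comp bet del ∧
  P.comp lam kap = P.zero y x ∧
  P.comp kap alp = P.comp gam lam

/-- the full subcategory supported by `S` is a diamond -/
def IsDiamondOn (P : RayCategory) (S : Set P.Obj) : Prop :=
  ∃ (x z t y : P.Obj) (gam : P.Hom x z) (lam : P.Hom z x) (del : P.Hom x t)
    (bet : P.Hom t y) (alp : P.Hom z y) (kap : P.Hom y z),
    DiamondData P x z t y gam lam del bet alp kap ∧ S = {x, z, t, y}

namespace RayCategory

variable {P : RayCategory}

theorem IsId.obj_eq {x y : P.Obj} {f : P.Hom x y} (h : P.IsId f) : x = y := h.1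

theorem IsId.eq_id {x : P.Obj} {f : P.Hom x x} (h : P.IsId f) : f = P.id x := by
  obtain ⟨_, h⟩ := h
  exact eq_of_heq h

theorem cancel_left {x y z : P.Obj} (g : P.Hom y z) {a b : P.Hom x y}
    (h : P.comp g a = P.comp g b) (h0 : P.comp g a ≠ P.zero x z) : a = b := by
  apply P.cancel (P.id x) a b g <;> simpa only [P.comp_id]

theorem cancel_right {x y z : P.Obj} (q : P.Hom x y) {a b : P.Hom y z}
    (h : P.comp a q = P.comp b q) (h0 : P.comp a q ≠ P.zero x z) : a = b := by
  apply P.cancel q a b (P.id z) <;> simpa only [P.id_comp]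

theorem pow_succ_comm {x : P.Obj} (f : P.Hom x x) (n : ℕ) :
    P.comp f (P.pow f n) = P.comp (P.pow f n) f := by
  induction n with
  | zero => simp only [pow, P.comp_id, P.id_comp]
  | succ n ih => rw [pow, P.assoc, ← ih]

theorem pow_eq_zero_of_le {x : P.Obj} (f : P.Hom x x) {m n : ℕ} (hmn : m ≤ n)
    (h : P.pow f m = P.zero x x) : P.pow f n = P.zero x x := by
  induction n, hmn using Nat.le_induction with
  | base => exact h
  | succ n _ ih => rw [pow, ih, P.comp_zero]

theorem pow_comp_eq_id {x : P.Obj} {f e : P.Hom x x} (h : P.comp f e = P.id x) (n : ℕ) :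
    ∃ e', P.comp (P.pow f n) e' = P.id x := by
  induction n with
  | zero => exact ⟨P.id x, P.comp_id _⟩
  | succ n ih =>
    obtain ⟨e', he'⟩ := ih
    exact ⟨P.comp e' e, by rw [pow, P.assoc, ← P.assoc _ e', he', P.id_comp, h]⟩

theorem comp_ne_id_of_nilpotent {x : P.Obj} {f : P.Hom x x} {n : ℕ}
    (hn : P.pow f n = P.zero x x) (hf : f ≠ P.zero x x) (e : P.Hom x x) :
    P.comp f e ≠ P.id x := by
  intro h
  obtain ⟨e', he'⟩ := pow_comp_eq_id h n
  rw [hn, P.zero_comp] at he'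
  apply hf
  rw [← P.comp_id f, ← he', P.comp_zero]

theorem pipow_eq_zero_of_le (x : P.Obj) {n : ℕ} (h : P.nilp x ≤ n) :
    P.pipow x n = P.zero x x := by
  induction n, h using Nat.le_induction with
  | base => exact P.pipow_nilp x
  | succ n _ ih => rw [P.pipow_succ, ih, P.comp_zero]

theorem finite_pipow (x : P.Obj) : (Set.range (P.pipow x)).Finite := by
  refine (((Finset.range (P.nilp x)).finite_toSet.image (P.pipow x)).insert (P.zero x x)).subset ?_
  rintro _ ⟨n, rfl⟩
  by_cases h : P.nilp x ≤ n
  · exact Or.inl (pipow_eq_zero_of_le x h)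
  · exact Or.inr ⟨n, by simpa using h, rfl⟩

instance finite_hom (x y : P.Obj) : Finite (P.Hom x y) := by
  obtain ⟨g, hg | hg⟩ := P.hom_cyclic x y
  · refine Set.finite_univ_iff.1 (((finite_pipow y).image fun e => P.comp e g).subset ?_)
    intro f _
    obtain ⟨i, rfl⟩ := hg f
    exact ⟨_, ⟨i, rfl⟩, rfl⟩
  · refine Set.finite_univ_iff.1 (((finite_pipow x).image fun e => P.comp g e).subset ?_)
    intro f _
    obtain ⟨i, rfl⟩ := hg f
    exact ⟨_, ⟨i, rfl⟩, rfl⟩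

/-- An irreducible endomorphism is the generator of the radical. -/
theorem pi_eq_of_isIrreducible {x : P.Obj} {f : P.Hom x x} (hf : P.IsIrreducible f) :
    P.pi x = f := by
  obtain ⟨_, hid, hfac⟩ := hf
  have hid' : f ≠ P.id x := fun h => hid ⟨rfl, heq_of_eq h⟩
  obtain ⟨i, hi⟩ := P.endo_cyclic x f
  cases i with
  | zero => exact absurd (hi.trans (P.pipow_zero x)) hid'
  | succ n =>
    rw [P.pipow_succ] at hi
    rcases hfac x _ _ hi with h | h
    · exfalso
      have h1 := h.eq_id
      have : ∀ m, P.pipow x m = P.id x := by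
        intro m
        induction m with
        | zero => exact P.pipow_zero x
        | succ m ih => rw [P.pipow_succ, ih, h1, P.comp_id]
      exact hid' (by rw [hi, this, this, P.comp_id])
    · rw [hi, h.eq_id, P.comp_id, pi]

theorem idealOf_comp_left {a b s t u : P.Obj} {m : P.Hom a b} {p : P.Hom s t} (g : P.Hom t u)
    (h : IdealOf P m s t p) : IdealOf P m s u (P.comp g p) := by
  obtain ⟨g', h', rfl⟩ := h
  exact ⟨P.comp g g', h', (P.assoc _ _ _).symm⟩

theorem idealOf_comp_right {a b s t u : P.Obj} {m : P.Hom a b} {p : P.Hom t u} (q : P.Hom s t)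
    (h : IdealOf P m t u p) : IdealOf P m s u (P.comp p q) := by
  obtain ⟨g', h', rfl⟩ := h
  exact ⟨g', P.comp h' q, by simp only [P.assoc]⟩

end RayCategory

/-! ### Modules generated by functions on morphisms -/

/-- The functions on the morphisms starting at `z`. -/
abbrev MorFun (P : RayCategory) (z : P.Obj) : Type := (Σ w, P.Hom z w) → ℚ × ℚ

namespace MorFun

variable {P : RayCategory}

/-- The action of a morphism on functions by precomposition. -/
def shift {a b : P.Obj} (q : P.Hom a b) : MorFun P a →ₗ[ℚ] MorFun P b :=
  LinearMap.funLeft ℚ (ℚ × ℚ) fun p => ⟨p.1, P.comp p.2 q⟩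

@[simp] theorem shift_apply {a b w : P.Obj} (q : P.Hom a b) (F : MorFun P a) (p : P.Hom b w) :
    shift q F ⟨w, p⟩ = F ⟨w, P.comp p q⟩ := rfl

theorem shift_id {a : P.Obj} (F : MorFun P a) : shift (P.id a) F = F := by
  funext ⟨w, p⟩
  rw [shift_apply, P.comp_id]

theorem shift_comp {a b c : P.Obj} (g : P.Hom b c) (f : P.Hom a b) (F : MorFun P a) :
    shift (P.comp g f) F = shift g (shift f F) := by
  funext ⟨w, p⟩
  simp only [shift_apply, P.assoc]

open Classical in
/-- The function with value `v` at `p` and value zero elsewhere. -/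
noncomputable def ind {z w : P.Obj} (p : P.Hom z w) : ℚ × ℚ →ₗ[ℚ] MorFun P z where
  toFun v := fun q => if q = ⟨w, p⟩ then v else 0
  map_add' u v := by funext q; by_cases h : q = ⟨w, p⟩ <;> simp [h]
  map_smul' a v := by funext q; by_cases h : q = ⟨w, p⟩ <;> simp [h]

@[simp] theorem ind_self {z w : P.Obj} (p : P.Hom z w) (v : ℚ × ℚ) : ind p v ⟨w, p⟩ = v := by
  simp [ind]

theorem ind_ne {z w : P.Obj} {p q : P.Hom z w} (h : q ≠ p) (v : ℚ × ℚ) :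
    ind p v ⟨w, q⟩ = 0 := by
  simp [ind, h]

theorem ind_obj_ne {z w w' : P.Obj} (h : w' ≠ w) (p : P.Hom z w) (q : P.Hom z w') (v : ℚ × ℚ) :
    ind p v ⟨w', q⟩ = 0 := by
  simp [ind, h]

/-- The submodule generated by a set of functions, cut down to the points in `D`. -/
def gen (D : Set P.Obj) (G : Set (Σ g, MorFun P g)) (z : P.Obj) : Submodule ℚ (MorFun P z) :=
  Submodule.span ℚ {F | z ∈ D ∧ ∃ E ∈ G, ∃ q : P.Hom E.1 z, F = shift q E.2}

variable {D : Set P.Obj} {G : Set (Σ g, MorFun P g)}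

theorem shift_mem_gen {g z : P.Obj} (hz : z ∈ D) {E : MorFun P g}
    (hE : (⟨g, E⟩ : Σ g, MorFun P g) ∈ G) (q : P.Hom g z) : shift q E ∈ gen D G z :=
  Submodule.subset_span ⟨hz, _, hE, q, rfl⟩

theorem mem_gen {g : P.Obj} (hg : g ∈ D) {E : MorFun P g}
    (hE : (⟨g, E⟩ : Σ g, MorFun P g) ∈ G) : E ∈ gen D G g := by
  simpa only [shift_id] using shift_mem_gen hg hE (P.id g)

theorem shift_mem {a b : P.Obj} (hb : b ∈ D) (q : P.Hom a b) {F : MorFun P a}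
    (hF : F ∈ gen D G a) : shift q F ∈ gen D G b := by
  induction hF using Submodule.span_induction with
  | mem F h =>
    obtain ⟨_, E, hE, q', rfl⟩ := h
    rw [← shift_comp]
    exact shift_mem_gen hb hE _
  | zero => simp
  | add F F' _ _ h h' => rw [map_add]; exact add_mem h h'
  | smul a F _ h => rw [map_smul]; exact Submodule.smul_mem _ a h

theorem gen_le {z : P.Obj} {S : Submodule ℚ (MorFun P z)}
    (h : ∀ E ∈ G, ∀ q : P.Hom E.1 z, shift q E.2 ∈ S) : gen D G z ≤ S := by
  refine Submodule.span_le.2 ?_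
  rintro _ ⟨_, E, hE, q, rfl⟩
  exact h E hE q

theorem gen_mono {D' : Set P.Obj} (hD : D ⊆ D') {z : P.Obj} {F : MorFun P z}
    (hF : F ∈ gen D G z) : F ∈ gen D' G z :=
  Submodule.span_mono (fun _ h => And.intro (hD h.1) h.2) hF

theorem eq_zero_of_mem_gen {z : P.Obj} (hz : z ∉ D) {F : MorFun P z} (hF : F ∈ gen D G z) :
    F = 0 := by
  have : gen D G z ≤ ⊥ := by
    refine Submodule.span_le.2 ?_
    rintro _ ⟨h, _⟩
    exact absurd h hz
  exact (Submodule.mem_bot ℚ).1 (this hF)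

/-- All functions of `G` vanish at the zero morphisms and on the ideal generated by `m`. -/
def Vanishing {s t : P.Obj} (m : P.Hom s t) (G : Set (Σ g, MorFun P g)) : Prop :=
  ∀ E ∈ G, ∀ (w : P.Obj) (p : P.Hom E.1 w), p = P.zero _ _ ∨ IdealOf P m _ _ p → E.2 ⟨w, p⟩ = 0

theorem Vanishing.apply_eq_zero {s t : P.Obj} {m : P.Hom s t} (h : Vanishing m G)
    {z w : P.Obj} {F : MorFun P z} (hF : F ∈ gen D G z) (p : P.Hom z w)
    (hp : p = P.zero _ _ ∨ IdealOf P m _ _ p) : F ⟨w, p⟩ = 0 := by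
  let S : Submodule ℚ (MorFun P z) := LinearMap.ker (LinearMap.proj ⟨w, p⟩)
  have : gen D G z ≤ S := by
    refine gen_le fun E hE q => ?_
    refine h E hE w (P.comp p q) ?_
    rcases hp with rfl | hp
    · exact Or.inl (P.zero_comp q)
    · exact Or.inr (RayCategory.idealOf_comp_right q hp)
  exact this hF

open Classical in
/-- The module given by the subspaces `gen D G z`. -/
noncomputable def toRMod {s t : P.Obj} {m : P.Hom s t} (h : Vanishing m G) :
    RMod P ℚ D (IdealOf P m) where
  M z := gen D G z
  act {a b} q := LinearMap.codRestrict (gen D G b)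
    (if b ∈ D then (shift q).comp (gen D G a).subtype else 0) (by
      intro F
      split_ifs with hb
      · exact shift_mem hb q F.2
      · simp)
  act_id z hz := by
    ext F : 2
    simp [hz, shift_id]
  act_comp {a b c} _ hb hc g f := by
    ext F : 2
    simp [hb, hc, shift_comp]
  act_zero {a b} _ hb := by
    ext F : 2
    simp only [hb, if_true, LinearMap.codRestrict_apply, LinearMap.zero_apply]
    funext ⟨w, p⟩
    exact h.apply_eq_zero F.2 _ (Or.inl (P.comp_zero p))
  supp z hz F := Subtype.ext (eq_zero_of_mem_gen hz F.2)
  killed {a b} f hf := by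
    ext F : 2
    simp only [LinearMap.codRestrict_apply, LinearMap.zero_apply]
    split_ifs with hb
    · funext ⟨w, p⟩
      exact h.apply_eq_zero F.2 _ (Or.inr (RayCategory.idealOf_comp_left p hf))
    · rfl

section toRMod

variable {s t : P.Obj} {m : P.Hom s t} (h : Vanishing m G)

/-- The inclusion of `toRMod` in the space of functions. -/
noncomputable def val (z : P.Obj) : (toRMod (D := D) h).M z →ₗ[ℚ] MorFun P z :=
  (gen D G z).subtype

theorem val_mem {z : P.Obj} (F : (toRMod (D := D) h).M z) : val h z F ∈ gen D G z := F.2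

theorem val_injective (z : P.Obj) : Function.Injective (val (D := D) h z) :=
  Subtype.val_injective

/-- Lift of a linear map with values in `gen D G z`. -/
noncomputable def lift {z : P.Obj} {V : Type} [AddCommGroup V] [Module ℚ V]
    (L : V →ₗ[ℚ] MorFun P z) (hL : ∀ v, L v ∈ gen D G z) : V →ₗ[ℚ] (toRMod (D := D) h).M z :=
  LinearMap.codRestrict (gen D G z) L hL

@[simp] theorem val_lift {z : P.Obj} {V : Type} [AddCommGroup V] [Module ℚ V]
    (L : V →ₗ[ℚ] MorFun P z) (hL : ∀ v, L v ∈ gen D G z) (v : V) :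
    val h z (lift h L hL v) = L v := rfl

theorem exists_val_eq {z : P.Obj} {F : MorFun P z} (hF : F ∈ gen D G z) :
    ∃ F' : (toRMod (D := D) h).M z, val h z F' = F := ⟨⟨F, hF⟩, rfl⟩

open Classical in
theorem val_act {a b : P.Obj} (hb : b ∈ D) (q : P.Hom a b) (F : (toRMod (D := D) h).M a) :
    val h b ((toRMod h).act q F) = shift q (val h a F) := by
  change (if b ∈ D then (shift q).comp (gen D G a).subtype else 0) F = _
  rw [if_pos hb]
  rfl

theorem finDim_toRMod (hD : D.Finite) (hG : G.Finite) : (toRMod (D := D) h).FinDim := by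
  refine ⟨fun z => ?_, hD.subset ?_⟩
  · have : {F : MorFun P z | z ∈ D ∧ ∃ E ∈ G, ∃ q : P.Hom E.1 z, F = shift q E.2}.Finite := by
      refine (hG.biUnion (t := fun E => Set.range fun q : P.Hom E.1 z => shift q E.2)
        fun E _ => Set.finite_range _).subset ?_
      rintro _ ⟨_, E, hE, q, rfl⟩
      exact Set.mem_biUnion hE ⟨q, rfl⟩
    exact FiniteDimensional.span_of_finite ℚ this
  · rintro z ⟨F, hF⟩
    by_contra hz
    exact hF ((toRMod h).supp z hz F)

end toRMod

variable {G' : Set (Σ g, MorFun P g)} {s t : P.Obj} {m : P.Hom s t} {h : Vanishing m G}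
  {h' : Vanishing m G'}

theorem val_hom_act (φ : RModHom (toRMod (D := D) h) (toRMod h')) {a b : P.Obj} (hb : b ∈ D)
    (q : P.Hom a b) (F : (toRMod (D := D) h).M a) :
    val h' b (φ.app b ((toRMod h).act q F)) = shift q (val h' a (φ.app a F)) := by
  rw [← val_act h' hb]
  exact congrArg (val h' b) (LinearMap.congr_fun (φ.natural q) F).symm

end MorFun

theorem exists_ne_bijective_of_repFin {P : RayCategory} {D : Set P.Obj}
    {I : ∀ a b : P.Obj, P.Hom a b → Prop} (hrep : RepFin P D I) (N : ℚ → RMod P ℚ D I)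
    (hfin : ∀ t, (N t).FinDim) (hind : ∀ t, (N t).Indec) (x : P.Obj)
    (hx : ∀ t, ∃ m : (N t).M x, m ≠ 0) :
    ∃ t t', t ≠ t' ∧ ∃ (φ : RModHom (N t) (N t')) (ψ : RModHom (N t') (N t)),
      ∀ z m, ψ.app z (φ.app z m) = m := by
  obtain ⟨ι, _, rep, hrep⟩ := hrep ℚ x
  choose i hi using fun t => hrep (N t) (hfin t) (hind t) (hx t)
  obtain ⟨t, t', hne, htt⟩ := Finite.exists_ne_map_eq_of_infinite i
  have inv : ∀ {M M' : RMod P ℚ D I} (φ : RModHom M M') (hφ : ∀ z, Function.Bijective (φ.app z)),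
      ∃ ψ : RModHom M' M, (∀ z m, ψ.app z (φ.app z m) = m) ∧ ∀ z m, φ.app z (ψ.app z m) = m := by
    intro M M' φ hφ
    let e := fun z => LinearEquiv.ofBijective (φ.app z) (hφ z)
    refine ⟨⟨fun z => (e z).symm.toLinearMap, ?_⟩, fun z m => (e z).symm_apply_apply m,
      fun z m => (e z).apply_symm_apply m⟩
    intro a b f
    ext m
    obtain ⟨m, rfl⟩ := (e a).surjective m
    simp only [LinearMap.comp_apply, LinearEquiv.coe_coe, LinearEquiv.symm_apply_apply]
    rw [LinearEquiv.eq_symm_apply]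
    exact (LinearMap.congr_fun (φ.natural f) m).symm
  have comp : ∀ {M M' M'' : RMod P ℚ D I} (ψ : RModHom M' M'') (φ : RModHom M M'),
      ∃ χ : RModHom M M'', ∀ z m, χ.app z m = ψ.app z (φ.app z m) := by
    intro M M' M'' ψ φ
    refine ⟨⟨fun z => (ψ.app z).comp (φ.app z), ?_⟩, fun _ _ => rfl⟩
    intro a b f
    rw [← LinearMap.comp_assoc, ψ.natural, LinearMap.comp_assoc, φ.natural, LinearMap.comp_assoc]
  obtain ⟨φ, hφ⟩ := hi t
  obtain ⟨ψ, hψ⟩ : RModIso (rep (i t)) (N t') := htt ▸ hi t'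
  obtain ⟨φ', h1, h2⟩ := inv φ hφ
  obtain ⟨ψ', h3, h4⟩ := inv ψ hψ
  obtain ⟨χ, hχ⟩ := comp ψ φ'
  obtain ⟨χ', hχ'⟩ := comp φ ψ'
  exact ⟨t, t', hne, χ, χ', fun z m => by rw [hχ, hχ', h3, h2]⟩

/-- A family of modules for which four lines in a plane, with variable cross-ratio, are preserved
by all homomorphisms is an obstruction to representation-finiteness. -/
theorem not_repFin_of_four_lines {P : RayCategory} {D : Set P.Obj}
    {I : ∀ a b : P.Obj, P.Hom a b → Prop} (N : ℚ → RMod P ℚ D I)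
    (hfin : ∀ t, (N t).FinDim) (y : P.Obj) (L : ∀ t, ℚ × ℚ →ₗ[ℚ] (N t).M y)
    (W : ∀ t, Submodule ℚ ((N t).M y)) (hL : ∀ t v, L t v ∈ W t → v = 0)
    (hW : ∀ t t' (φ : RModHom (N t) (N t')), ∀ m ∈ W t, φ.app y m ∈ W t')
    (h1 : ∀ t t' (φ : RModHom (N t) (N t')),
      ∃ a : ℚ, φ.app y (L t (1, 0)) - L t' (a • (1, 0)) ∈ W t')
    (h2 : ∀ t t' (φ : RModHom (N t) (N t')),
      ∃ a : ℚ, φ.app y (L t (0, 1)) - L t' (a • (0, 1)) ∈ W t')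
    (h3 : ∀ t t' (φ : RModHom (N t) (N t')),
      ∃ a : ℚ, φ.app y (L t (1, 1)) - L t' (a • (1, 1)) ∈ W t')
    (h4 : ∀ t t' (φ : RModHom (N t) (N t')),
      ∃ a : ℚ, φ.app y (L t (1, t)) - L t' (a • (1, t')) ∈ W t')
    (hnil : ∀ t (e : RModHom (N t) (N t)), (∀ z, (e.app z).comp (e.app z) = e.app z) →
      (∀ v, e.app y (L t v) ∈ W t) → ∀ z, e.app z = 0) :
    ¬ RepFin P D I := by
  have key : ∀ t t' (φ : RModHom (N t) (N t')), ∃ a : ℚ,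
      (∀ v, φ.app y (L t v) - L t' (a • v) ∈ W t') ∧ (t ≠ t' → a = 0) := by
    intro t t' φ
    obtain ⟨a, ha⟩ := h1 t t' φ
    obtain ⟨b, hb⟩ := h2 t t' φ
    obtain ⟨c, hc⟩ := h3 t t' φ
    obtain ⟨d, hd⟩ := h4 t t' φ
    have hv : ∀ v : ℚ × ℚ, φ.app y (L t v) - L t' (a * v.1, b * v.2) ∈ W t' := by
      intro v
      have e1 : v = v.1 • ((1, 0) : ℚ × ℚ) + v.2 • ((0, 1) : ℚ × ℚ) := by ext <;> simp
      have e2 : ((a * v.1, b * v.2) : ℚ × ℚ) =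
          v.1 • (a • ((1, 0) : ℚ × ℚ)) + v.2 • (b • ((0, 1) : ℚ × ℚ)) := by
        ext <;> simp [mul_comm]
      rw [e2]
      nth_rewrite 1 [e1]
      simp only [map_add, (L t).map_smul v.1, (L t).map_smul v.2, (L t').map_smul v.1,
        (L t').map_smul v.2, (φ.app y).map_smul]
      have := add_mem ((W t').smul_mem v.1 ha) ((W t').smul_mem v.2 hb)
      convert this using 1
      simp only [smul_sub]
      abel
    have hab : a = c ∧ b = c := by
      have := hL t' _ (by
        have := sub_mem hc (hv (1, 1))
        rw [sub_sub_sub_cancel_left, ← map_sub] at this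
        exact this)
      simp [Prod.ext_iff, sub_eq_zero] at this
      exact this
    obtain ⟨rfl, rfl⟩ := hab
    refine ⟨b, fun v => hv v, fun hne => ?_⟩
    have := hL t' _ (by
      have := sub_mem hd (hv (1, t))
      rw [sub_sub_sub_cancel_left, ← map_sub] at this
      exact this)
    simp [Prod.ext_iff, sub_eq_zero] at this
    obtain ⟨rfl, h⟩ := this
    by_contra hb0
    exact hne (mul_left_cancel₀ hb0 h)
  have hLne : ∀ t, L t (1, 0) ∉ W t := fun t h => by simpa using hL t _ h
  intro hrep
  obtain ⟨t, t', hne, φ, ψ, hφψ⟩ := exists_ne_bijective_of_repFin hrep N hfin (fun t => by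
    refine ⟨⟨y, L t (1, 0), fun h => hLne t (h ▸ zero_mem _)⟩, fun e he => ?_⟩
    obtain ⟨a, ha, -⟩ := key t t e
    have haa : a = 0 ∨ a = 1 := by
      have e0 : e.app y (e.app y (L t (1, 0))) = e.app y (L t (1, 0)) :=
        LinearMap.congr_fun (he y) _
      have e1 := hW t t e _ (ha (1, 0))
      rw [map_sub, e0, map_smul, map_smul] at e1
      have e2 := (W t).smul_mem a (ha (1, 0))
      have e3 := sub_mem (add_mem e1 e2) (ha (1, 0))
      have e4 : L t ((a - a * a) • (1, 0)) ∈ W t := by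
        convert e3 using 1
        simp only [map_smul]
        module
      have := hL t _ e4
      simp [Prod.ext_iff] at this
      have h' : a * (a - 1) = 0 := by linarith
      rcases mul_eq_zero.1 h' with h | h
      · exact Or.inl h
      · exact Or.inr (by linarith)
    rcases haa with rfl | rfl
    · refine Or.inl (hnil t e he fun v => ?_)
      simpa using ha v
    · refine Or.inr ?_
      let e' : RModHom (N t) (N t) := ⟨fun z => LinearMap.id - e.app z, fun f => by
        rw [LinearMap.comp_sub, LinearMap.sub_comp, e.natural, LinearMap.comp_id,
          LinearMap.id_comp]⟩
      have := hnil t e' (fun z => by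
        simp only [e', LinearMap.comp_sub, LinearMap.sub_comp, he, LinearMap.comp_id,
          LinearMap.id_comp]
        abel) (fun v => by
          have := (W t).neg_mem (ha v)
          simpa [e'] using this)
      intro z
      exact (sub_eq_zero.1 (this z)).symm) y
    (fun t => ⟨L t (1, 0), fun h => hLne t (h ▸ zero_mem _)⟩)
  obtain ⟨a, ha, ha0⟩ := key t t' φ
  have h := ha (1, 0)
  rw [ha0 hne, zero_smul, map_zero, sub_zero] at h
  have := hW t' t ψ _ h
  rw [hφψ] at this
  exact hLne t this

/-! ### A dumb-bell with a third arrow ending at `y` -/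

/-- Two points `x`, `y` supporting a dumb-bell together with an additional arrow `f : c → y`. -/
structure DumbBellWithArrow (P : RayCategory) {x y c : P.Obj} (lam : P.Hom x x) (mu : P.Hom x y)
    (rho : P.Hom y y) (f : P.Hom c y) : Prop where
  x_ne_y : x ≠ y
  c_ne_x : c ≠ x
  c_ne_y : c ≠ y
  irr_mu : P.IsIrreducible mu
  irr_rho : P.IsIrreducible rho
  irr_f : P.IsIrreducible f
  comm : P.comp mu lam = P.comp rho mu
  hom_xx : ∀ e : P.Hom x x, e = P.id x ∨ ∃ e', e = P.comp e' lam
  hom_yy : ∀ e : P.Hom y y, e = P.id y ∨ ∃ e', e = P.comp e' rho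
  lam_comm : ∀ e : P.Hom x x, P.comp lam e = P.comp e lam
  rho_comm : ∀ e : P.Hom y y, P.comp rho e = P.comp e rho
  hom_xy : ∀ p : P.Hom x y, p = P.zero x y ∨ ∃ e, p = P.comp e mu
  hom_yx : ∀ p : P.Hom y x, p = P.zero y x
  comp_lam_ne : ∀ e, P.comp e lam ≠ P.id x
  comp_rho_ne : ∀ e, P.comp e rho ≠ P.id y
  lam_lam : P.comp lam lam ≠ P.zero x x
  rho_rho : P.comp rho rho ≠ P.zero y y
  rho_rho_mu : P.comp rho (P.comp rho mu) ≠ P.zero x y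

namespace DumbBellWithArrow

open RayCategory MorFun

variable {P : RayCategory} {x y c : P.Obj} {lam : P.Hom x x} {mu : P.Hom x y}
  {rho : P.Hom y y} {f : P.Hom c y}

theorem rho_mu (B : DumbBellWithArrow P lam mu rho f) : P.comp rho mu ≠ P.zero x y := fun h =>
  B.rho_rho_mu (by rw [h, P.comp_zero])

theorem rho_ne_id (B : DumbBellWithArrow P lam mu rho f) : rho ≠ P.id y := fun h =>
  B.comp_rho_ne (P.id y) (by rw [P.id_comp, h])

theorem f_ne_rho_comp (B : DumbBellWithArrow P lam mu rho f)
    (m : P.Hom c y) : f ≠ P.comp rho m := fun h => by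
  rcases B.irr_f.2.2 _ _ _ h with h | h
  · exact B.rho_ne_id h.eq_id
  · exact B.c_ne_y h.obj_eq

theorem f_ne_mu_comp (B : DumbBellWithArrow P lam mu rho f)
    (m : P.Hom c x) : f ≠ P.comp mu m := fun h => by
  rcases B.irr_f.2.2 _ _ _ h with h | h
  · exact B.x_ne_y h.obj_eq
  · exact B.c_ne_x h.obj_eq

theorem eq_id_of_f_eq (B : DumbBellWithArrow P lam mu rho f)
    {p : P.Hom c y} {q : P.Hom c c} (h : f = P.comp p q) : q = P.id c := by
  rcases B.irr_f.2.2 _ _ _ h with h | h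
  · exact absurd h.obj_eq B.c_ne_y
  · exact h.eq_id

theorem mu_ne_rho_comp (B : DumbBellWithArrow P lam mu rho f)
    (m : P.Hom x y) : mu ≠ P.comp rho m := fun h => by
  rcases B.irr_mu.2.2 _ _ _ h with h | h
  · exact B.rho_ne_id h.eq_id
  · exact B.x_ne_y h.obj_eq

theorem mu_ne_f_comp (B : DumbBellWithArrow P lam mu rho f)
    (m : P.Hom x c) : mu ≠ P.comp f m := fun h => by
  rcases B.irr_mu.2.2 _ _ _ h with h | h
  · exact B.c_ne_y h.obj_eq
  · exact B.c_ne_x h.obj_eq.symm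

theorem rho_ne_comp (B : DumbBellWithArrow P lam mu rho f)
    {p : P.Hom c y} (m : P.Hom y c) : rho ≠ P.comp p m := fun h => by
  rcases B.irr_rho.2.2 _ _ _ h with h | h
  · exact B.c_ne_y h.obj_eq
  · exact B.c_ne_y h.obj_eq.symm

theorem id_ne_f_comp (B : DumbBellWithArrow P lam mu rho f)
    (m : P.Hom y c) : P.comp f m ≠ P.id y := fun h => by
  have h1 : P.comp f (P.comp m f) = P.comp f (P.id c) := by
    rw [← P.assoc, h, P.id_comp, P.comp_id]
  have h2 := cancel_left f h1 (by rw [h1, P.comp_id]; exact B.irr_f.1)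
  exact B.c_ne_y (P.no_iso f m h2 h)

theorem rho_ne_comp_rho_rho (B : DumbBellWithArrow P lam mu rho f)
    (e : P.Hom y y) : P.comp e (P.comp rho rho) ≠ rho := fun h => by
  rw [← P.assoc] at h
  have h1 : P.comp (P.comp e rho) rho = P.comp (P.id y) rho := by rw [h, P.id_comp]
  exact B.comp_rho_ne e (cancel_right rho h1 (by rw [h]; exact B.irr_rho.1))

theorem ideal_y (B : DumbBellWithArrow P lam mu rho f) {a : P.Obj} {p : P.Hom a y}
    (h : IdealOf P (P.comp rho (P.comp mu lam)) a y p) :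
    ∃ m : P.Hom a y, p = P.comp rho (P.comp rho m) := by
  obtain ⟨e, m, rfl⟩ := h
  refine ⟨P.comp e (P.comp mu m), ?_⟩
  rw [B.comm]
  simp only [P.assoc]
  rw [← P.assoc e, ← B.rho_comm, P.assoc, ← P.assoc e, ← B.rho_comm, P.assoc]

theorem ideal_yy (B : DumbBellWithArrow P lam mu rho f)
    {p : P.Hom y y} (h : IdealOf P (P.comp rho (P.comp mu lam)) y y p) :
    p = P.zero y y := by
  obtain ⟨e, m, rfl⟩ := h
  rw [B.hom_yx m, P.comp_zero, P.comp_zero]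

theorem ideal_xx (B : DumbBellWithArrow P lam mu rho f)
    {p : P.Hom x x} (h : IdealOf P (P.comp rho (P.comp mu lam)) x x p) :
    p = P.zero x x := by
  obtain ⟨e, m, rfl⟩ := h
  rw [B.hom_yx e, P.zero_comp]

theorem rho_rho_mu_mem (B : DumbBellWithArrow P lam mu rho f) (e : P.Hom y y) :
    IdealOf P (P.comp rho (P.comp mu lam)) x y (P.comp e (P.comp rho (P.comp rho mu))) :=
  ⟨e, P.id x, by rw [P.comp_id, B.comm]⟩

end DumbBellWithArrow

namespace MorFun

variable {P : RayCategory}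

/-- Evaluation of the first component. -/
def ev₁ {z w : P.Obj} (p : P.Hom z w) : MorFun P z →ₗ[ℚ] ℚ :=
  (LinearMap.fst ℚ ℚ ℚ).comp (LinearMap.proj ⟨w, p⟩)

/-- Evaluation of the second component. -/
def ev₂ {z w : P.Obj} (p : P.Hom z w) : MorFun P z →ₗ[ℚ] ℚ :=
  (LinearMap.snd ℚ ℚ ℚ).comp (LinearMap.proj ⟨w, p⟩)

theorem ev₁_apply {z w : P.Obj} (p : P.Hom z w) (F : MorFun P z) : ev₁ p F = (F ⟨w, p⟩).1 := rfl

theorem eq_of_mem_gen {D : Set P.Obj} {G : Set (Σ g, MorFun P g)} {z : P.Obj} {V : Type}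
    [AddCommGroup V] [Module ℚ V] (T T' : MorFun P z →ₗ[ℚ] V)
    (h : ∀ E ∈ G, ∀ q : P.Hom E.1 z, T (shift q E.2) = T' (shift q E.2))
    {F : MorFun P z} (hF : F ∈ gen D G z) : T F = T' F := by
  have : gen D G z ≤ LinearMap.eqLocus T T' := gen_le h
  exact this hF

end MorFun

namespace MorFun

variable {P : RayCategory}

@[simp] theorem ind_zero_zero {z w : P.Obj} (p : P.Hom z w) : ind p (0, 0) = 0 :=
  map_zero (ind p)

@[simp] theorem ind_snd_fst {z w : P.Obj} (p : P.Hom z w) (b : ℚ) (q : Σ w, P.Hom z w) :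
    (ind p (0, b) q).1 = 0 := by
  by_cases h : q = ⟨w, p⟩ <;> simp [ind, h]

@[simp] theorem ind_fst_snd {z w : P.Obj} (p : P.Hom z w) (a : ℚ) (q : Σ w, P.Hom z w) :
    (ind p (a, 0) q).2 = 0 := by
  by_cases h : q = ⟨w, p⟩ <;> simp [ind, h]

theorem ind_eq_zero {z w s t : P.Obj} {m : P.Hom s t} {p : P.Hom z w} (hp : p ≠ P.zero z w)
    (hp' : ¬ IdealOf P m z w p) {w' : P.Obj} {q : P.Hom z w'}
    (hq : q = P.zero z w' ∨ IdealOf P m z w' q) (v : ℚ × ℚ) : ind p v ⟨w', q⟩ = 0 := by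
  by_cases h : w' = w
  · subst h
    refine ind_ne ?_ v
    rintro rfl
    exact hq.elim hp hp'
  · exact ind_obj_ne h p q v

variable {D : Set P.Obj} {G G' : Set (Σ g, MorFun P g)} {s t : P.Obj} {m : P.Hom s t}
  {h : Vanishing m G} {h' : Vanishing m G'}

theorem val_hom_eq (φ : RModHom (toRMod (D := D) h) (toRMod h')) {a b : P.Obj} (hb : b ∈ D)
    (q : P.Hom a b) {F : (toRMod (D := D) h).M a} {F' : (toRMod (D := D) h).M b}
    (hF : val h b F' = shift q (val h a F)) :
    val h' b (φ.app b F') = shift q (val h' a (φ.app a F)) := by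
  rw [← val_act h hb] at hF
  rw [val_injective h b hF, val_hom_act φ hb]

end MorFun

namespace DumbBellWithArrow

open RayCategory MorFun

variable {P : RayCategory} {x y c : P.Obj} {lam : P.Hom x x} {mu : P.Hom x y}
  {rho : P.Hom y y} {f : P.Hom c y}

theorem mu_not_mem (B : DumbBellWithArrow P lam mu rho f) :
    ¬ IdealOf P (P.comp rho (P.comp mu lam)) x y mu := fun h => by
  obtain ⟨m, hm⟩ := B.ideal_y h
  exact B.mu_ne_rho_comp _ hm

theorem f_not_mem (B : DumbBellWithArrow P lam mu rho f) :
    ¬ IdealOf P (P.comp rho (P.comp mu lam)) c y f := fun h => by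
  obtain ⟨m, hm⟩ := B.ideal_y h
  exact B.f_ne_rho_comp _ hm

theorem rho_mu_not_mem (B : DumbBellWithArrow P lam mu rho f) :
    ¬ IdealOf P (P.comp rho (P.comp mu lam)) x y (P.comp rho mu) :=
  fun h => by
    obtain ⟨m, hm⟩ := B.ideal_y h
    exact B.mu_ne_rho_comp m (cancel_left rho hm B.rho_mu)

theorem rho_f_not_mem (B : DumbBellWithArrow P lam mu rho f) (hf : P.comp rho f ≠ P.zero c y) :
    ¬ IdealOf P (P.comp rho (P.comp mu lam)) c y (P.comp rho f) := fun h => by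
  obtain ⟨m, hm⟩ := B.ideal_y h
  exact B.f_ne_rho_comp m (cancel_left rho hm hf)

theorem endo_cases (B : DumbBellWithArrow P lam mu rho f) (e : P.Hom y y) :
    e = P.id y ∨ e = rho ∨ ∃ e', e = P.comp e' (P.comp rho rho) := by
  obtain rfl | ⟨e', rfl⟩ := B.hom_yy e
  · exact Or.inl rfl
  · obtain rfl | ⟨e'', rfl⟩ := B.hom_yy e'
    · exact Or.inr (Or.inl (P.id_comp _))
    · exact Or.inr (Or.inr ⟨e'', P.assoc _ _ _⟩)

theorem comp_rho_rho (B : DumbBellWithArrow P lam mu rho f) (e : P.Hom y y) :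
    P.comp e (P.comp rho rho) = P.comp rho (P.comp rho e) := by
  rw [← P.assoc, ← B.rho_comm (P.comp e rho), ← B.rho_comm e]

/-- The generators used when `ρ f ≠ 0`. -/
noncomputable def gens (mu : P.Hom x y) (rho : P.Hom y y) (f : P.Hom c y) (t : ℚ) :
    Set (Σ g, MorFun P g) :=
  {⟨x, ind mu (1, 0) + ind (P.comp rho mu) (0, 1)⟩, ⟨y, ind (P.comp rho rho) (0, 1)⟩,
    ⟨c, ind f (1, 0) + ind (P.comp rho f) (0, t)⟩}

theorem gens_finite (t : ℚ) : (gens mu rho f t).Finite := by simp [gens]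

theorem mem_gens_x (t : ℚ) :
    (⟨x, ind mu (1, 0) + ind (P.comp rho mu) (0, 1)⟩ : Σ g, MorFun P g) ∈ gens mu rho f t := by
  simp [gens]

theorem mem_gens_y (t : ℚ) :
    (⟨y, ind (P.comp rho rho) (0, 1)⟩ : Σ g, MorFun P g) ∈ gens mu rho f t := by
  simp [gens]

theorem mem_gens_c (t : ℚ) :
    (⟨c, ind f (1, 0) + ind (P.comp rho f) (0, t)⟩ : Σ g, MorFun P g) ∈ gens mu rho f t := by
  simp [gens]

theorem forall_gens {t : ℚ} {Q : ∀ g, MorFun P g → Prop}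
    (hx : Q x (ind mu (1, 0) + ind (P.comp rho mu) (0, 1)))
    (hy : Q y (ind (P.comp rho rho) (0, 1)))
    (hc : Q c (ind f (1, 0) + ind (P.comp rho f) (0, t))) :
    ∀ E ∈ gens mu rho f t, Q E.1 E.2 := by
  rintro E (rfl | rfl | rfl)
  exacts [hx, hy, hc]

variable {D : Set P.Obj} {t : ℚ}

theorem gens_vanishing (B : DumbBellWithArrow P lam mu rho f)
    (hf : P.comp rho f ≠ P.zero c y) (t : ℚ) :
    Vanishing (P.comp rho (P.comp mu lam)) (gens mu rho f t) := by
  refine forall_gens (Q := fun g E => ∀ (w : P.Obj) (p : P.Hom g w), p = P.zero _ _ ∨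
    IdealOf P (P.comp rho (P.comp mu lam)) _ _ p → E ⟨w, p⟩ = 0) ?_ ?_ ?_
  · intro w p hp
    rw [Pi.add_apply, ind_eq_zero B.irr_mu.1 B.mu_not_mem hp,
      ind_eq_zero B.rho_mu B.rho_mu_not_mem hp, add_zero]
  · intro w p hp
    exact ind_eq_zero B.rho_rho (fun h => B.rho_rho (B.ideal_yy h)) hp _
  · intro w p hp
    rw [Pi.add_apply, ind_eq_zero B.irr_f.1 B.f_not_mem hp,
      ind_eq_zero hf (B.rho_f_not_mem hf) hp, add_zero]

theorem gens_apply_ne {z w : P.Obj} (hw : w ≠ y) {F : MorFun P z}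
    (hF : F ∈ gen D (gens mu rho f t) z) (p : P.Hom z w) : F ⟨w, p⟩ = 0 := by
  refine eq_of_mem_gen (LinearMap.proj ⟨w, p⟩) 0 ?_ hF
  refine forall_gens (Q := fun g E => ∀ q : P.Hom g z, E ⟨w, P.comp p q⟩ = 0) ?_ ?_ ?_ <;>
  · intro q
    simp [ind_obj_ne hw]

theorem gens_fst_rho_comp (B : DumbBellWithArrow P lam mu rho f)
    {z : P.Obj} {F : MorFun P z} (hF : F ∈ gen D (gens mu rho f t) z)
    (p : P.Hom z y) : (F ⟨y, P.comp rho p⟩).1 = 0 := by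
  refine eq_of_mem_gen (ev₁ (P.comp rho p)) 0 ?_ hF
  refine forall_gens
    (Q := fun g E => ∀ q : P.Hom g z, (E ⟨y, P.comp (P.comp rho p) q⟩).1 = 0) ?_ ?_ ?_ <;>
  intro q <;> rw [P.assoc]
  · simp [ind_ne (B.mu_ne_rho_comp _).symm]
  · simp
  · simp [ind_ne (B.f_ne_rho_comp _).symm]

theorem gens_rho_rho_rho (B : DumbBellWithArrow P lam mu rho f)
    (hf : P.comp rho f ≠ P.zero c y) {z : P.Obj} {F : MorFun P z}
    (hF : F ∈ gen D (gens mu rho f t) z) (p : P.Hom z y) :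
    F ⟨y, P.comp rho (P.comp rho (P.comp rho p))⟩ = 0 := by
  refine eq_of_mem_gen (LinearMap.proj ⟨y, _⟩) 0 ?_ hF
  refine forall_gens (Q := fun g E => ∀ q : P.Hom g z,
    E ⟨y, P.comp (P.comp rho (P.comp rho (P.comp rho p))) q⟩ = 0) ?_ ?_ ?_ <;>
  intro q <;> simp only [P.assoc, Pi.add_apply]
  · rw [ind_ne (B.mu_ne_rho_comp _).symm, ind_ne, add_zero]
    exact fun h => B.mu_ne_rho_comp _ (cancel_left rho h.symm B.rho_mu)
  · rw [ind_ne]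
    intro h
    have h1 := cancel_left rho h.symm B.rho_rho
    refine B.comp_rho_ne (P.comp p q) ?_
    rw [← B.rho_comm]
    exact (cancel_left rho (by rw [P.comp_id]; exact h1)
      (by rw [P.comp_id]; exact B.irr_rho.1)).symm
  · rw [ind_ne (B.f_ne_rho_comp _).symm, ind_ne, add_zero]
    exact fun h => B.f_ne_rho_comp _ (cancel_left rho h.symm hf)

theorem gens_x (B : DumbBellWithArrow P lam mu rho f)
    (hf : P.comp rho f ≠ P.zero c y) {F : MorFun P x}
    (hF : F ∈ gen D (gens mu rho f t) x) : (F ⟨y, P.comp rho mu⟩).2 = (F ⟨y, mu⟩).1 := by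
  have hv := B.gens_vanishing hf t
  refine eq_of_mem_gen (ev₂ (P.comp rho mu)) (ev₁ mu) ?_ hF
  refine forall_gens (Q := fun g E => ∀ q : P.Hom g x,
    (E ⟨y, P.comp (P.comp rho mu) q⟩).2 = (E ⟨y, P.comp mu q⟩).1) ?_ ?_ ?_ <;> intro q
  · obtain rfl | ⟨q', rfl⟩ := B.hom_xx q
    · simp only [P.comp_id]
      simp [ind_ne (B.mu_ne_rho_comp _)]
    · have h0 := hv _ (mem_gens_x t) _ _ (Or.inr ⟨P.id y, q', rfl⟩)
      rw [P.id_comp, B.comm] at h0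
      have h1 : P.comp mu (P.comp q' lam) = P.comp rho (P.comp mu q') := by
        rw [← B.lam_comm, ← P.assoc, B.comm, P.assoc]
      simp only [P.assoc] at h0
      rw [P.assoc, h1, h0]
      simp [ind_ne (B.mu_ne_rho_comp _).symm]
  · have h0 := hv _ (mem_gens_y t) y _ (Or.inl rfl)
    dsimp only at h0
    rw [B.hom_yx q, P.comp_zero, P.comp_zero, h0]
    rfl
  · rw [P.assoc, Pi.add_apply, Pi.add_apply, ind_ne (B.f_ne_rho_comp _).symm, ind_ne,
      ind_ne (B.f_ne_mu_comp _).symm]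
    · simp
    · exact fun h => B.f_ne_mu_comp _ (cancel_left rho h.symm hf)

theorem gens_c (B : DumbBellWithArrow P lam mu rho f)
    (hf : P.comp rho f ≠ P.zero c y) {F : MorFun P c}
    (hF : F ∈ gen D (gens mu rho f t) c) : (F ⟨y, P.comp rho f⟩).2 = t * (F ⟨y, f⟩).1 := by
  refine eq_of_mem_gen (ev₂ (P.comp rho f)) (t • ev₁ f) ?_ hF
  refine forall_gens (Q := fun g E => ∀ q : P.Hom g c,
    (E ⟨y, P.comp (P.comp rho f) q⟩).2 = t * (E ⟨y, P.comp f q⟩).1) ?_ ?_ ?_ <;> intro q <;>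
    rw [P.assoc]
  · rw [Pi.add_apply, Pi.add_apply, ind_ne (B.mu_ne_rho_comp _).symm, ind_ne,
      ind_ne (B.mu_ne_f_comp _).symm]
    · simp
    · exact fun h => B.mu_ne_f_comp _ (cancel_left rho h.symm B.rho_mu)
  · rw [ind_ne]
    · simp
    · exact fun h => B.rho_ne_comp _ (cancel_left rho h.symm B.rho_rho)
  · by_cases hq : q = P.id c
    · subst hq
      simp only [P.comp_id]
      simp [ind_ne (B.f_ne_rho_comp _).symm]
    · have h1 : P.comp f q ≠ f := fun h => hq (B.eq_id_of_f_eq h.symm)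
      rw [Pi.add_apply, Pi.add_apply, ind_ne (B.f_ne_rho_comp _).symm, ind_ne, ind_ne h1]
      · simp
      · exact fun h => h1 (cancel_left rho h.symm hf).symm

theorem gens_rho_rho_f (B : DumbBellWithArrow P lam mu rho f)
    (hf : P.comp rho f ≠ P.zero c y) {F : MorFun P c}
    (hF : F ∈ gen D (gens mu rho f t) c) : F ⟨y, P.comp rho (P.comp rho f)⟩ = 0 := by
  refine eq_of_mem_gen (LinearMap.proj ⟨y, _⟩) 0 ?_ hF
  refine forall_gens (Q := fun g E => ∀ q : P.Hom g c,
    E ⟨y, P.comp (P.comp rho (P.comp rho f)) q⟩ = 0) ?_ ?_ ?_ <;>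
  intro q <;> simp only [P.assoc, Pi.add_apply]
  · rw [ind_ne (B.mu_ne_rho_comp _).symm, ind_ne, add_zero]
    exact fun h => B.mu_ne_rho_comp _ (cancel_left rho h.symm B.rho_mu)
  · rw [ind_ne]
    intro h
    have h1 := cancel_left rho h.symm B.rho_rho
    exact B.id_ne_f_comp q (cancel_left rho (by rw [P.comp_id]; exact h1)
      (by rw [P.comp_id]; exact B.irr_rho.1)).symm
  · rw [ind_ne (B.f_ne_rho_comp _).symm, ind_ne, add_zero]
    exact fun h => B.f_ne_rho_comp _ (cancel_left rho h.symm hf)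

theorem eq_ind_add_ind (B : DumbBellWithArrow P lam mu rho f)
    {F : MorFun P y} (hw : ∀ (w : P.Obj), w ≠ y → ∀ p, F ⟨w, p⟩ = 0)
    (h1 : (F ⟨y, rho⟩).1 = 0) (h2 : ∀ e, F ⟨y, P.comp e (P.comp rho rho)⟩ = 0) :
    F = ind (P.id y) (F ⟨y, P.id y⟩) + ind rho (0, (F ⟨y, rho⟩).2) := by
  funext ⟨w, p⟩
  by_cases h : w = y
  · subst h
    obtain rfl | rfl | ⟨e, rfl⟩ := B.endo_cases p
    · simp [ind_ne B.rho_ne_id.symm]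
    · simp [ind_ne B.rho_ne_id, Prod.ext_iff, h1]
    · rw [h2, Pi.add_apply, ind_ne (B.rho_ne_comp_rho_rho e), ind_ne, add_zero]
      rw [← P.assoc]
      exact B.comp_rho_ne _
  · rw [hw w h, Pi.add_apply, ind_obj_ne h, ind_obj_ne h, add_zero]

end DumbBellWithArrow

namespace DumbBellWithArrow

open RayCategory MorFun

variable {P : RayCategory} {x y c : P.Obj} {lam : P.Hom x x} {mu : P.Hom x y}
  {rho : P.Hom y y} {f : P.Hom c y}

/-- The plane containing the four lines used when `ρ f ≠ 0`. -/
noncomputable def plane (rho : P.Hom y y) : ℚ × ℚ →ₗ[ℚ] MorFun P y :=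
  (ind (P.id y)).comp (LinearMap.inl ℚ ℚ ℚ ∘ₗ LinearMap.fst ℚ ℚ ℚ) +
    (ind rho).comp (LinearMap.inr ℚ ℚ ℚ ∘ₗ LinearMap.snd ℚ ℚ ℚ)

theorem plane_apply (v : ℚ × ℚ) :
    plane rho v = ind (P.id y) (v.1, 0) + ind rho (0, v.2) := rfl

/-- The socle along which the plane is considered. -/
noncomputable def socle (P : RayCategory) (y : P.Obj) : Submodule ℚ (MorFun P y) :=
  LinearMap.range ((ind (P.id y)).comp (LinearMap.inr ℚ ℚ ℚ))

theorem ind_mem_socle (s : ℚ) : ind (P.id y) (0, s) ∈ socle P y := ⟨s, rfl⟩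

theorem eq_zero_of_plane_mem_socle (B : DumbBellWithArrow P lam mu rho f)
    {v : ℚ × ℚ} (hv : plane rho v ∈ socle P y) : v = 0 := by
  obtain ⟨s, hs⟩ := hv
  have h1 := congrFun hs ⟨y, P.id y⟩
  have h2 := congrFun hs ⟨y, rho⟩
  simp [plane_apply, ind_ne B.rho_ne_id.symm, Prod.ext_iff] at h1
  simp [plane_apply, ind_ne B.rho_ne_id, Prod.ext_iff] at h2
  exact Prod.ext h1.1.symm h2.symm

theorem rho_ne_rho_rho (B : DumbBellWithArrow P lam mu rho f) : rho ≠ P.comp rho rho := fun h =>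
  B.rho_ne_comp_rho_rho (P.id y) (by rw [P.id_comp, ← h])

variable {D : Set P.Obj} {t : ℚ}

theorem eq_plane_add (B : DumbBellWithArrow P lam mu rho f)
    {F : MorFun P y} (hF : F ∈ gen D (gens mu rho f t) y)
    (h2 : ∀ e, F ⟨y, P.comp e (P.comp rho rho)⟩ = 0) :
    F = plane rho ((F ⟨y, P.id y⟩).1, (F ⟨y, rho⟩).2) + ind (P.id y) (0, (F ⟨y, P.id y⟩).2) := by
  have h := B.eq_ind_add_ind (fun w hw => gens_apply_ne hw hF)
    (by simpa only [P.comp_id] using B.gens_fst_rho_comp hF (P.id y)) h2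
  refine h.trans ?_
  rw [plane_apply, add_right_comm, ← map_add]
  simp

theorem eq_of_shift_rho_eq_zero (B : DumbBellWithArrow P lam mu rho f)
    {F : MorFun P y} (hF : F ∈ gen D (gens mu rho f t) y)
    (h : shift rho F = 0) :
    F = plane rho ((F ⟨y, P.id y⟩).1, 0) + ind (P.id y) (0, (F ⟨y, P.id y⟩).2) := by
  have h0 : ∀ e, F ⟨y, P.comp e rho⟩ = 0 := fun e => congrFun h ⟨y, e⟩
  have h1 := B.eq_plane_add hF (fun e => by rw [← P.assoc]; exact h0 _)
  have h2 := h0 (P.id y)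
  rw [P.id_comp] at h2
  rw [h2] at h1
  exact h1

theorem shift_mu (B : DumbBellWithArrow P lam mu rho f) (hf : P.comp rho f ≠ P.zero c y)
    {F : MorFun P x} (hF : F ∈ gen D (gens mu rho f t) x) :
    shift mu F = plane rho ((F ⟨y, mu⟩).1, (F ⟨y, mu⟩).1) +
      ind (P.id y) (0, (F ⟨y, mu⟩).2) := by
  have h := B.eq_plane_add (D := Set.univ) (shift_mem (Set.mem_univ y) mu
    (gen_mono (Set.subset_univ D) hF)) (fun e => ?_)
  · simpa only [shift_apply, P.id_comp, B.gens_x hf hF] using h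
  · rw [shift_apply, P.assoc, P.assoc]
    exact (B.gens_vanishing hf t).apply_eq_zero hF _ (Or.inr (B.rho_rho_mu_mem e))

theorem shift_f (B : DumbBellWithArrow P lam mu rho f) (hf : P.comp rho f ≠ P.zero c y)
    {F : MorFun P c} (hF : F ∈ gen D (gens mu rho f t) c) :
    shift f F = plane rho ((F ⟨y, f⟩).1, t * (F ⟨y, f⟩).1) +
      ind (P.id y) (0, (F ⟨y, f⟩).2) := by
  have h := B.eq_plane_add (D := Set.univ) (shift_mem (Set.mem_univ y) f
    (gen_mono (Set.subset_univ D) hF)) (fun e => ?_)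
  · simpa only [shift_apply, P.id_comp, B.gens_c hf hF] using h
  · rw [shift_apply]
    obtain rfl | ⟨e, rfl⟩ := B.hom_yy e
    · rw [P.id_comp, P.assoc]
      exact B.gens_rho_rho_f hf hF
    · rw [B.comp_rho_rho, ← B.rho_comm e, P.assoc, P.assoc, P.assoc]
      exact B.gens_rho_rho_rho hf hF _

theorem shift_rho (B : DumbBellWithArrow P lam mu rho f) (hf : P.comp rho f ≠ P.zero c y)
    {F : MorFun P y} (hF : F ∈ gen D (gens mu rho f t) y) :
    shift rho F = plane rho (0, (F ⟨y, P.comp rho rho⟩).2) + ind (P.id y) (0, (F ⟨y, rho⟩).2) := by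
  have h := B.eq_plane_add (D := Set.univ) (shift_mem (Set.mem_univ y) rho
    (gen_mono (Set.subset_univ D) hF)) (fun e => ?_)
  · have h0 := B.gens_fst_rho_comp hF (P.id y)
    rw [P.comp_id] at h0
    simpa only [shift_apply, P.id_comp, h0] using h
  · rw [shift_apply, B.comp_rho_rho, P.assoc, P.assoc, ← B.rho_comm]
    exact B.gens_rho_rho_rho hf hF _

theorem shift_rho_rho (B : DumbBellWithArrow P lam mu rho f) (hf : P.comp rho f ≠ P.zero c y)
    {F : MorFun P y} (hF : F ∈ gen D (gens mu rho f t) y) :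
    shift (P.comp rho rho) F = ind (P.id y) (0, (F ⟨y, P.comp rho rho⟩).2) := by
  have h := B.shift_rho (D := Set.univ) hf (shift_mem (Set.mem_univ y) rho
    (gen_mono (Set.subset_univ D) hF))
  have h0 := B.gens_rho_rho_rho hf hF (P.id y)
  rw [P.comp_id] at h0
  rw [shift_comp, h, shift_apply, shift_apply, P.assoc, h0]
  exact (congrArg (· + _) (map_zero (plane rho))).trans (zero_add _)

theorem plane_one_one (B : DumbBellWithArrow P lam mu rho f) (hf : P.comp rho f ≠ P.zero c y) :
    plane rho (1, 1) =
    shift mu (ind mu (1, 0) + ind (P.comp rho mu) (0, 1)) := by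
  rw [B.shift_mu (D := Set.univ) (f := f) (t := 0) hf (mem_gen (Set.mem_univ x) (mem_gens_x 0))]
  simp [ind_ne (B.mu_ne_rho_comp _)]

theorem plane_one_right (B : DumbBellWithArrow P lam mu rho f) (hf : P.comp rho f ≠ P.zero c y)
    (t : ℚ) : plane rho (1, t) =
    shift f (ind f (1, 0) + ind (P.comp rho f) (0, t)) := by
  rw [B.shift_f (D := Set.univ) (mu := mu) (t := t) hf
    (mem_gen (Set.mem_univ c) (mem_gens_c t))]
  simp [ind_ne (B.f_ne_rho_comp _)]

theorem plane_zero_one (B : DumbBellWithArrow P lam mu rho f) (hf : P.comp rho f ≠ P.zero c y) :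
    plane rho (0, 1) = shift rho (ind (P.comp rho rho) (0, 1)) := by
  rw [B.shift_rho (D := Set.univ) (f := f) (t := 0) hf
    (mem_gen (Set.mem_univ y) (mem_gens_y 0))]
  simp [ind_ne B.rho_ne_rho_rho]

theorem ind_id_eq (B : DumbBellWithArrow P lam mu rho f) (hf : P.comp rho f ≠ P.zero c y) (s : ℚ) :
    ind (P.id y) (0, s) = shift (P.comp rho rho) (s • ind (P.comp rho rho) (0, 1)) := by
  rw [map_smul, B.shift_rho_rho (D := Set.univ) (f := f) (t := 0) hf
    (mem_gen (Set.mem_univ y) (mem_gens_y 0)), ← map_smul]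
  simp

theorem plane_mem (B : DumbBellWithArrow P lam mu rho f) (hf : P.comp rho f ≠ P.zero c y)
    (hy : y ∈ D) (v : ℚ × ℚ) : plane rho v ∈ gen D (gens mu rho f t) y := by
  have h : v = v.1 • ((1, 1) : ℚ × ℚ) + (v.2 - v.1) • ((0, 1) : ℚ × ℚ) := by ext <;> simp
  rw [h, map_add, map_smul, map_smul, B.plane_one_one hf, B.plane_zero_one hf]
  exact add_mem (Submodule.smul_mem _ _ (shift_mem_gen hy (mem_gens_x t) mu))
    (Submodule.smul_mem _ _ (shift_mem_gen hy (mem_gens_y t) rho))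

theorem shift_rho_plane (B : DumbBellWithArrow P lam mu rho f) (hf : P.comp rho f ≠ P.zero c y)
    (a b : ℚ) : shift rho (plane rho (a, b)) = ind (P.id y) (0, b) := by
  rw [B.shift_rho (D := Set.univ) (t := 0) hf (B.plane_mem hf (Set.mem_univ y) (a, b))]
  simp [plane_apply, ind_ne B.rho_ne_rho_rho.symm]

theorem not_repFin_of_comp_ne (B : DumbBellWithArrow P lam mu rho f) (hf : P.comp rho f ≠ P.zero c y) :
    ¬ RepFin P {x, y, c} (IdealOf P (P.comp rho (P.comp mu lam))) := by
  let D : Set P.Obj := {x, y, c}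
  have hx : x ∈ D := by simp [D]
  have hy : y ∈ D := by simp [D]
  have hc : c ∈ D := by simp [D]
  have hD : D.Finite := by simp [D]
  let K := B.gens_vanishing hf
  have hsub : ∀ {F : MorFun P y} (v : ℚ × ℚ) (s : ℚ), F = plane rho v + ind (P.id y) (0, s) →
      F - plane rho v ∈ socle P y := by
    rintro F v s rfl
    rw [add_sub_cancel_left]
    exact ind_mem_socle s
  have hline : ∀ {t : ℚ} (m : (toRMod (D := D) (K t)).M y) (v : ℚ × ℚ) {u : ℚ × ℚ} {s : ℚ},
      val (K t) y m = plane rho u + ind (P.id y) (0, s) → (∃ a : ℚ, a • v = u) →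
      ∃ a : ℚ, m - lift (K t) (plane rho) (B.plane_mem hf hy) (a • v) ∈
        (socle P y).comap (val (K t) y) := by
    rintro t m v _ s hm ⟨a, rfl⟩
    exact ⟨a, hsub _ _ hm⟩
  have hgy : ∀ t, ∃ E : (toRMod (D := D) (K t)).M y,
      val (K t) y E = ind (P.comp rho rho) (0, 1) :=
    fun t => exists_val_eq (K t) (mem_gen hy (mem_gens_y t))
  refine not_repFin_of_four_lines (fun t => toRMod (D := D) (K t))
    (fun t => finDim_toRMod _ hD (gens_finite t)) y
    (fun t => lift (K t) (plane rho) (B.plane_mem hf hy))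
    (fun t => (socle P y).comap (val (K t) y)) (fun t v hv => B.eq_zero_of_plane_mem_socle hv)
    ?_ ?_ ?_ ?_ ?_ ?_
  · rintro t t' φ m ⟨s, hs⟩
    obtain ⟨E, hE⟩ := hgy t
    have h := val_hom_eq φ hy (P.comp rho rho) (F := s • E) (F' := m) (by
      rw [map_smul, hE, ← B.ind_id_eq hf]; exact hs.symm)
    rw [B.shift_rho_rho hf (val_mem _ _)] at h
    exact ⟨_, h.symm⟩
  · intro t t' φ
    have h := val_hom_eq φ hy rho (F := lift (K t) (plane rho) (B.plane_mem hf hy) (1, 0))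
      (F' := 0) (by rw [val_lift, B.shift_rho_plane hf, map_zero, ind_zero_zero])
    rw [map_zero, map_zero] at h
    exact hline _ _ (B.eq_of_shift_rho_eq_zero (val_mem _ _) h.symm)
      ⟨_, Prod.ext (mul_one _) (mul_zero _)⟩
  · intro t t' φ
    obtain ⟨E, hE⟩ := exists_val_eq (D := D) (K t) (mem_gen hy (mem_gens_y t))
    have h := val_hom_eq φ hy rho (F := E) (F' := lift (K t) (plane rho) (B.plane_mem hf hy) (0, 1))
      (by rw [val_lift, hE, B.plane_zero_one hf])
    exact hline _ _ (h.trans (B.shift_rho hf (val_mem _ _)))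
      ⟨_, Prod.ext (mul_zero _) (mul_one _)⟩
  · intro t t' φ
    obtain ⟨E, hE⟩ := exists_val_eq (D := D) (K t) (mem_gen hx (mem_gens_x t))
    have h := val_hom_eq φ hy mu (F := E) (F' := lift (K t) (plane rho) (B.plane_mem hf hy) (1, 1))
      (by rw [val_lift, hE, B.plane_one_one hf])
    exact hline _ _ (h.trans (B.shift_mu hf (val_mem _ _)))
      ⟨_, Prod.ext (mul_one _) (mul_one _)⟩
  · intro t t' φ
    obtain ⟨E, hE⟩ := exists_val_eq (D := D) (K t) (mem_gen hc (mem_gens_c t))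
    have h := val_hom_eq φ hy f (F := E) (F' := lift (K t) (plane rho) (B.plane_mem hf hy) (1, t))
      (by rw [val_lift, hE, B.plane_one_right hf])
    exact hline _ _ (h.trans (B.shift_f hf (val_mem _ _)))
      ⟨_, Prod.ext (mul_one _) (mul_comm _ _)⟩
  · intro t e he hL
    have hS : ∀ m : (toRMod (D := D) (K t)).M y, val (K t) y m ∈ socle P y → e.app y m = 0 := by
      rintro m ⟨s, hs⟩
      have h := val_hom_eq e hy rho (F := lift (K t) (plane rho) (B.plane_mem hf hy) (0, s))
        (F' := m) (by rw [val_lift, B.shift_rho_plane hf]; exact hs.symm)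
      obtain ⟨s', hs'⟩ := hL (0, s)
      apply val_injective (K t)
      rw [h, ← hs', map_zero]
      funext ⟨w, p⟩
      by_cases hw : w = y
      · subst hw
        exact ind_ne (B.comp_rho_ne p) _
      · exact ind_obj_ne hw _ _ _
    have hS' : ∀ (m : (toRMod (D := D) (K t)).M y) (v : ℚ × ℚ) (s : ℚ),
        val (K t) y m = plane rho v + ind (P.id y) (0, s) → e.app y m = 0 := by
      intro m v s hm
      have h1 := hS (m - lift (K t) (plane rho) (B.plane_mem hf hy) v) (by
        rw [map_sub, val_lift]
        exact hsub v s hm)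
      have h2 := hS _ (hL v)
      have h3 : e.app y (e.app y _) = e.app y _ := LinearMap.congr_fun (he y)
        (lift (K t) (plane rho) (B.plane_mem hf hy) v)
      rw [map_sub, ← h3, h2, sub_zero] at h1
      exact h1
    have hy0 : ∀ m, e.app y m = 0 := by
      intro m
      have h1 := hS' ((toRMod (K t)).act rho m) _ _
        ((val_act (K t) hy rho m).trans (B.shift_rho hf (val_mem _ _)))
      have h2 := val_hom_act e hy rho m
      rw [h1, map_zero] at h2
      have h3 := hS' (e.app y m) _ _ (B.eq_of_shift_rho_eq_zero (val_mem _ _) h2.symm)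
      exact (LinearMap.congr_fun (he y) m).symm.trans h3
    intro z
    ext m
    apply val_injective (K t)
    funext ⟨w, p⟩
    rw [LinearMap.zero_apply, map_zero, Pi.zero_apply]
    by_cases hw : w = y
    · subst hw
      have h := congrFun (val_hom_act e hy p m) ⟨w, P.id w⟩
      rw [hy0, map_zero, shift_apply, P.id_comp] at h
      exact h.symm
    · exact gens_apply_ne hw (val_mem _ _) p

end DumbBellWithArrow

namespace MorFun

variable {P : RayCategory} {D : Set P.Obj} {G : Set (Σ g, MorFun P g)} {s t : P.Obj}
  {m : P.Hom s t} {h : Vanishing m G}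

theorem toRMod_hom_ext {z : P.Obj} {V : Type} [AddCommGroup V] [Module ℚ V]
    {T T' : (toRMod (D := D) h).M z →ₗ[ℚ] V}
    (H : ∀ E ∈ G, ∀ (q : P.Hom E.1 z) (F : (toRMod (D := D) h).M z),
      val h z F = shift q E.2 → T F = T' F) : T = T' := by
  have key : ∀ (F : MorFun P z) (hF : F ∈ gen D G z), T ⟨F, hF⟩ = T' ⟨F, hF⟩ := by
    intro F hF
    induction hF using Submodule.span_induction with
    | mem F hF =>
      obtain ⟨_, E, hE, q, hq⟩ := hF
      exact H E hE q _ hq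
    | zero => exact (map_zero T).trans (map_zero T').symm
    | add F F' hF hF' h1 h2 =>
      exact (map_add T (⟨F, hF⟩ : gen D G z) ⟨F', hF'⟩).trans
        ((congrArg₂ (· + ·) h1 h2).trans (map_add T' (⟨F, hF⟩ : gen D G z) ⟨F', hF'⟩).symm)
    | smul a F hF h1 =>
      exact (map_smul T a (⟨F, hF⟩ : gen D G z)).trans
        ((congrArg (a • ·) h1).trans (map_smul T' a (⟨F, hF⟩ : gen D G z)).symm)
  exact LinearMap.ext fun F => key F.1 F.2

end MorFun

namespace DumbBellWithArrow

open RayCategory MorFun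

variable {P : RayCategory} {x y c : P.Obj} {lam : P.Hom x x} {mu : P.Hom x y}
  {rho : P.Hom y y} {f : P.Hom c y}

theorem lam_ne_comp_lam (B : DumbBellWithArrow P lam mu rho f) (e : P.Hom x x) :
    P.comp e (P.comp lam lam) ≠ lam := fun h => by
  rw [← P.assoc] at h
  have h0 : lam ≠ P.zero x x := fun h => B.lam_lam (by rw [h, P.comp_zero])
  exact B.comp_lam_ne e (cancel_right lam (by rw [h, P.id_comp]) (by rwa [h]))

theorem endo_cases_x (B : DumbBellWithArrow P lam mu rho f) (e : P.Hom x x) :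
    e = P.id x ∨ e = lam ∨ ∃ e', e = P.comp e' (P.comp lam lam) := by
  obtain rfl | ⟨e', rfl⟩ := B.hom_xx e
  · exact Or.inl rfl
  · obtain rfl | ⟨e'', rfl⟩ := B.hom_xx e'
    · exact Or.inr (Or.inl (P.id_comp _))
    · exact Or.inr (Or.inr ⟨e'', P.assoc _ _ _⟩)

theorem mu_lam_mem (B : DumbBellWithArrow P lam mu rho f) (e : P.Hom x x) :
    IdealOf P (P.comp rho (P.comp mu lam)) x y (P.comp mu (P.comp lam (P.comp lam e))) := by
  refine ⟨P.id y, e, ?_⟩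
  have h : P.comp mu (P.comp lam (P.comp lam e)) = P.comp rho (P.comp mu (P.comp lam e)) := by
    rw [← P.assoc, B.comm, P.assoc]
  rw [P.id_comp, h, P.assoc, P.assoc]

theorem mu_lam (B : DumbBellWithArrow P lam mu rho f) : P.comp mu lam ≠ P.zero x y := by
  rw [B.comm]
  exact B.rho_mu

theorem mu_lam_not_mem (B : DumbBellWithArrow P lam mu rho f) :
    ¬ IdealOf P (P.comp rho (P.comp mu lam)) x y (P.comp mu lam) := by
  have h := B.rho_mu_not_mem
  rwa [← B.comm] at h

theorem mu_ne_comp_lam (B : DumbBellWithArrow P lam mu rho f) (p : P.Hom x y) :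
    P.comp p lam ≠ mu := fun h => by
  obtain rfl | ⟨e, rfl⟩ := B.hom_xy p
  · exact B.irr_mu.1 (by rw [← h, P.zero_comp])
  · rw [P.assoc, B.comm, ← P.assoc, ← B.rho_comm, P.assoc] at h
    exact B.mu_ne_rho_comp _ h.symm

theorem comp_lam_lam_mem (B : DumbBellWithArrow P lam mu rho f) (p : P.Hom x y) :
    p = P.zero x y ∨ IdealOf P (P.comp rho (P.comp mu lam)) x y (P.comp p (P.comp lam lam)) := by
  obtain h | ⟨e, rfl⟩ := B.hom_xy p
  · exact Or.inl h
  · refine Or.inr ?_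
    rw [P.assoc]
    have := B.mu_lam_mem (P.id x)
    rw [P.comp_id] at this
    exact idealOf_comp_left e this

/-- The generators used when `ρ f = 0`. -/
noncomputable def gens₀ (lam : P.Hom x x) (mu : P.Hom x y) (f : P.Hom c y) (Fy : MorFun P y)
    (Th : MorFun P x) (t : ℚ) : Set (Σ g, MorFun P g) :=
  {⟨y, Fy⟩, ⟨x, ind (P.comp mu lam) (0, 1) + ind (P.comp lam lam) (1, 0) + Th⟩,
    ⟨x, ind mu (1, 1)⟩, ⟨c, ind f (1, t)⟩}

variable {Fy : MorFun P y} {Th : MorFun P x} {t : ℚ} {D : Set P.Obj}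

theorem gens₀_finite (t : ℚ) : (gens₀ lam mu f Fy Th t).Finite := by simp [gens₀]

theorem mem_gens₀_y (t : ℚ) : (⟨y, Fy⟩ : Σ g, MorFun P g) ∈ gens₀ lam mu f Fy Th t := by
  simp [gens₀]

theorem mem_gens₀_x (t : ℚ) :
    (⟨x, ind (P.comp mu lam) (0, 1) + ind (P.comp lam lam) (1, 0) + Th⟩ : Σ g, MorFun P g) ∈
      gens₀ lam mu f Fy Th t := by
  simp [gens₀]

theorem mem_gens₀_x' (t : ℚ) :
    (⟨x, ind mu (1, 1)⟩ : Σ g, MorFun P g) ∈ gens₀ lam mu f Fy Th t := by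
  simp [gens₀]

theorem mem_gens₀_c (t : ℚ) :
    (⟨c, ind f (1, t)⟩ : Σ g, MorFun P g) ∈ gens₀ lam mu f Fy Th t := by
  simp [gens₀]

theorem forall_gens₀ {Q : ∀ g, MorFun P g → Prop} (hy : Q y Fy)
    (hx : Q x (ind (P.comp mu lam) (0, 1) + ind (P.comp lam lam) (1, 0) + Th))
    (hx' : Q x (ind mu (1, 1))) (hc : Q c (ind f (1, t))) :
    ∀ E ∈ gens₀ lam mu f Fy Th t, Q E.1 E.2 := by
  rintro E (rfl | rfl | rfl | rfl)
  exacts [hy, hx, hx', hc]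

/-- The conditions on `Fy` and `Th` which make `gens₀` suitable. -/
structure Suitable (lam : P.Hom x x) (mu : P.Hom x y) (rho : P.Hom y y) (f : P.Hom c y)
    (Fy : MorFun P y) (Th : MorFun P x) : Prop where
  vanish_y : ∀ (w : P.Obj) (p : P.Hom y w),
    p = P.zero _ _ ∨ IdealOf P (P.comp rho (P.comp mu lam)) _ _ p → Fy ⟨w, p⟩ = 0
  ne_y : ∀ (w : P.Obj) (p : P.Hom y w), w ≠ y → Fy ⟨w, p⟩ = 0
  y_f : ∀ q, Fy ⟨y, P.comp f q⟩ = 0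
  vanish_x : ∀ (w : P.Obj) (p : P.Hom x w),
    p = P.zero _ _ ∨ IdealOf P (P.comp rho (P.comp mu lam)) _ _ p → Th ⟨w, p⟩ = 0
  ne_c : ∀ (w : P.Obj) (p : P.Hom x w), w ≠ c → Th ⟨w, p⟩ = 0
  comp_lam : ∀ p : P.Hom x c, Th ⟨c, P.comp p lam⟩ = 0
  comp_f : ∀ (p : P.Hom y c) (b : P.Hom x c), Th ⟨c, P.comp p (P.comp f b)⟩ = 0

theorem gens₀_vanishing (B : DumbBellWithArrow P lam mu rho f)
    (S : Suitable lam mu rho f Fy Th) (t : ℚ) :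
    Vanishing (P.comp rho (P.comp mu lam)) (gens₀ lam mu f Fy Th t) := by
  refine forall_gens₀ (Q := fun g E => ∀ (w : P.Obj) (p : P.Hom g w), p = P.zero _ _ ∨
    IdealOf P (P.comp rho (P.comp mu lam)) _ _ p → E ⟨w, p⟩ = 0) S.vanish_y ?_ ?_ ?_
  · intro w p hp
    rw [Pi.add_apply, Pi.add_apply, S.vanish_x w p hp,
      ind_eq_zero B.lam_lam (fun h => B.lam_lam (B.ideal_xx h)) hp,
      ind_eq_zero B.mu_lam B.mu_lam_not_mem hp,
      add_zero, add_zero]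
  · exact fun w p hp => ind_eq_zero B.irr_mu.1 B.mu_not_mem hp _
  · exact fun w p hp => ind_eq_zero B.irr_f.1 B.f_not_mem hp _

theorem gens₀_apply_ne (S : Suitable lam mu rho f Fy Th) {z w : P.Obj} (hwx : w ≠ x)
    (hwy : w ≠ y) (hwc : w ≠ c) {F : MorFun P z} (hF : F ∈ gen D (gens₀ lam mu f Fy Th t) z)
    (p : P.Hom z w) : F ⟨w, p⟩ = 0 := by
  refine eq_of_mem_gen (LinearMap.proj ⟨w, p⟩) 0 ?_ hF
  refine forall_gens₀ (Q := fun g E => ∀ q : P.Hom g z, E ⟨w, P.comp p q⟩ = 0) ?_ ?_ ?_ ?_ <;>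
    intro q
  · exact S.ne_y _ _ hwy
  · simp [ind_obj_ne hwx, ind_obj_ne hwy, S.ne_c _ _ hwc]
  · exact ind_obj_ne hwy _ _ _
  · exact ind_obj_ne hwy _ _ _

theorem ex_apply_y (B : DumbBellWithArrow P lam mu rho f) (S : Suitable lam mu rho f Fy Th)
    (p : P.Hom x y) :
    (ind (P.comp mu lam) (0, 1) + ind (P.comp lam lam) (1, 0) + Th) ⟨y, p⟩ =
      ind (P.comp mu lam) (0, 1) ⟨y, p⟩ := by
  rw [Pi.add_apply, Pi.add_apply, ind_obj_ne B.x_ne_y.symm, S.ne_c _ _ B.c_ne_y.symm, add_zero,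
    add_zero]

theorem ex_apply_x (B : DumbBellWithArrow P lam mu rho f) (S : Suitable lam mu rho f Fy Th)
    (p : P.Hom x x) :
    (ind (P.comp mu lam) (0, 1) + ind (P.comp lam lam) (1, 0) + Th) ⟨x, p⟩ =
      ind (P.comp lam lam) (1, 0) ⟨x, p⟩ := by
  rw [Pi.add_apply, Pi.add_apply, ind_obj_ne B.x_ne_y, S.ne_c _ _ B.c_ne_x.symm, add_zero,
    zero_add]

theorem ex_apply_c (B : DumbBellWithArrow P lam mu rho f) (p : P.Hom x c) :
    (ind (P.comp mu lam) (0, 1) + ind (P.comp lam lam) (1, 0) + Th) ⟨c, p⟩ = Th ⟨c, p⟩ := by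
  rw [Pi.add_apply, Pi.add_apply, ind_obj_ne B.c_ne_x, ind_obj_ne B.c_ne_y, zero_add, zero_add]

theorem mu_lam_ne_mu (B : DumbBellWithArrow P lam mu rho f) (e : P.Hom x x) :
    P.comp mu (P.comp lam e) ≠ mu := by
  rw [B.lam_comm, ← P.assoc]
  exact B.mu_ne_comp_lam _

theorem lam_lam_ne (B : DumbBellWithArrow P lam mu rho f) (e : P.Hom x x) :
    P.comp lam (P.comp lam (P.comp lam e)) ≠ P.comp lam lam := fun h => by
  refine B.lam_ne_comp_lam e ?_
  rw [← P.assoc, ← B.lam_comm e, P.assoc, ← B.lam_comm e]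
  exact cancel_left lam h (by rw [h]; exact B.lam_lam)

/-- The functions occurring at the point `x`. -/
theorem gens₀_x (B : DumbBellWithArrow P lam mu rho f) (S : Suitable lam mu rho f Fy Th)
    {F : MorFun P x} (hF : F ∈ gen D (gens₀ lam mu f Fy Th t) x) :
    (F ⟨y, mu⟩).2 = (F ⟨y, mu⟩).1 + (F ⟨x, lam⟩).1 ∧
    F ⟨y, P.comp mu lam⟩ = (0, (F ⟨x, P.comp lam lam⟩).1) ∧
    (∀ b, F ⟨c, b⟩ = (F ⟨x, P.comp lam lam⟩).1 • Th ⟨c, b⟩) ∧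
    (∀ e, (F ⟨x, e⟩).2 = 0) ∧
    (∀ e, F ⟨x, P.comp lam (P.comp lam (P.comp lam e))⟩ = 0) := by
  let Q : MorFun P x → Prop := fun F => (F ⟨y, mu⟩).2 = (F ⟨y, mu⟩).1 + (F ⟨x, lam⟩).1 ∧
    F ⟨y, P.comp mu lam⟩ = (0, (F ⟨x, P.comp lam lam⟩).1) ∧
    (∀ b, F ⟨c, b⟩ = (F ⟨x, P.comp lam lam⟩).1 • Th ⟨c, b⟩) ∧
    (∀ e, (F ⟨x, e⟩).2 = 0) ∧
    (∀ e, F ⟨x, P.comp lam (P.comp lam (P.comp lam e))⟩ = 0)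
  have h0 : Q 0 := by simp [Q, Prod.ext_iff]
  let W : Submodule ℚ (MorFun P x) :=
    { carrier := {F | Q F}
      zero_mem' := h0
      add_mem' := by
        rintro F F' ⟨h1, h2, h3, h4, h5⟩ ⟨h1', h2', h3', h4', h5'⟩
        refine ⟨?_, ?_, fun b => ?_, fun e => ?_, fun e => ?_⟩
        · simp only [Pi.add_apply, Prod.fst_add, Prod.snd_add, h1, h1']
          ring
        · simp [Pi.add_apply, h2, h2']
        · simp only [Pi.add_apply, h3, h3', Prod.fst_add, add_smul]
        · simp [h4, h4']
        · simp [h5, h5']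
      smul_mem' := by
        rintro a F ⟨h1, h2, h3, h4, h5⟩
        refine ⟨?_, ?_, fun b => ?_, fun e => ?_, fun e => ?_⟩
        · simp only [Pi.smul_apply, Prod.smul_fst, Prod.smul_snd, h1, smul_add]
        · simp [h2]
        · simp only [Pi.smul_apply, h3, Prod.smul_fst, smul_assoc]
        · simp [h4]
        · simp [h5] }
  suffices h : ∀ E ∈ gens₀ lam mu f Fy Th t, ∀ q : P.Hom E.1 x, shift q E.2 ∈ W from gen_le h hF
  refine forall_gens₀ (Q := fun g E => ∀ q : P.Hom g x, shift q E ∈ W) ?_ ?_ ?_ ?_ <;> intro q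
  · have : shift q Fy = 0 := by
      funext ⟨w, p⟩
      rw [shift_apply, B.hom_yx q, P.comp_zero]
      exact S.vanish_y _ _ (Or.inl rfl)
    rw [this]
    exact W.zero_mem
  · change Q _
    have hv := B.gens₀_vanishing S t
    have hz : ∀ p, p = P.zero x y ∨ IdealOf P (P.comp rho (P.comp mu lam)) x y p →
        ind (P.comp mu lam) (0, 1) ⟨y, p⟩ = 0 := fun p hp =>
      (B.ex_apply_y S p).symm.trans (hv _ (mem_gens₀_x t) y p hp)
    simp only [Q, shift_apply, B.ex_apply_y S, B.ex_apply_x S, B.ex_apply_c, P.assoc]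
    have hq : ∀ e, ind (P.comp lam lam) (1, 0) ⟨x, P.comp lam (P.comp lam (P.comp lam e))⟩ = 0 :=
      fun e => ind_ne (B.lam_lam_ne e) _
    have hm := B.mu_lam_ne_mu (P.id x)
    have hl := B.lam_ne_comp_lam (P.id x)
    rw [P.comp_id] at hm
    rw [P.id_comp] at hl
    obtain rfl | ⟨e, rfl⟩ := B.hom_xx q
    · simp only [P.comp_id]
      refine ⟨?_, ?_, ?_, fun _ => ind_fst_snd _ _ _, hq⟩
      · simp [ind_ne hm.symm, ind_ne hl.symm]
      · simp
      · simp
    · obtain rfl | ⟨e, rfl⟩ := B.hom_xx e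
      · simp only [P.id_comp]
        have h3 := hq (P.id x)
        have h4 := hz _ (Or.inr (B.mu_lam_mem (P.id x)))
        rw [P.comp_id] at h3 h4
        refine ⟨?_, ?_, ?_, fun _ => ind_fst_snd _ _ _, fun e => hq _⟩
        · simp
        · simp [h3, h4, Prod.ext_iff]
        · simp [h3, S.comp_lam]
      · rw [← B.lam_comm, ← B.lam_comm e]
        refine ⟨?_, ?_, ?_, fun _ => ind_fst_snd _ _ _, fun e => hq _⟩
        · rw [hz _ (Or.inr (B.mu_lam_mem e)), hq]
          simp
        · rw [hz _ (Or.inr (B.mu_lam_mem _)), hq]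
          rfl
        · intro b
          rw [hq, B.lam_comm (P.comp lam e), ← P.assoc, S.comp_lam]
          simp
  · change Q _
    simp only [Q, shift_apply, ind_obj_ne B.x_ne_y, ind_obj_ne B.c_ne_y]
    obtain rfl | ⟨e, rfl⟩ := B.hom_xx q
    · have hm := B.mu_lam_ne_mu (P.id x)
      rw [P.comp_id] at hm
      simp [P.comp_id, ind_ne hm, Prod.ext_iff]
    · rw [← P.assoc mu e, ind_ne (B.mu_ne_comp_lam _), ← P.assoc, ind_ne (B.mu_ne_comp_lam _)]
      simp [Prod.ext_iff]
  · change Q _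
    simp only [Q, shift_apply, ind_obj_ne B.x_ne_y, ind_obj_ne B.c_ne_y]
    rw [ind_ne (B.f_ne_mu_comp _).symm, P.assoc, ind_ne (B.f_ne_mu_comp _).symm]
    simp [Prod.ext_iff]

end DumbBellWithArrow

namespace MorFun

variable {P : RayCategory}

theorem shift_ind_self {a b : P.Obj} {q : P.Hom a b} (hq : q ≠ P.zero a b) (v : ℚ × ℚ) :
    shift q (ind q v) = ind (P.id b) v := by
  funext ⟨w, p⟩
  rw [shift_apply]
  by_cases hw : w = b
  · subst hw
    by_cases hp : p = P.id w
    · rw [hp, P.id_comp, ind_self, ind_self]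
    · rw [ind_ne hp, ind_ne]
      intro h
      exact hp (RayCategory.cancel_right q (by rw [h, P.id_comp]) (by rwa [h]))
  · rw [ind_obj_ne hw, ind_obj_ne hw]

theorem shift_ind_eq_zero {a b d : P.Obj} {q : P.Hom a b} {r : P.Hom a d}
    (h : ∀ p : P.Hom b d, P.comp p q ≠ r) (v : ℚ × ℚ) : shift q (ind r v) = 0 := by
  funext ⟨w, p⟩
  rw [shift_apply]
  by_cases hw : w = d
  · subst hw
    exact ind_ne (h p) v
  · exact ind_obj_ne hw _ _ _

end MorFun

namespace DumbBellWithArrow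

open RayCategory MorFun

variable {P : RayCategory} {x y c : P.Obj} {lam : P.Hom x x} {mu : P.Hom x y}
  {rho : P.Hom y y} {f : P.Hom c y} {Fy : MorFun P y} {Th : MorFun P x} {t : ℚ} {D : Set P.Obj}

theorem comp_ne_mu_lam (B : DumbBellWithArrow P lam mu rho f) (hf : P.comp rho f = P.zero c y)
    (b : P.Hom x c) : P.comp f b ≠ P.comp mu lam := fun h => by
  refine B.rho_rho_mu ?_
  rw [← B.comm, ← h, ← P.assoc, hf, P.zero_comp]

theorem gens₀_c (B : DumbBellWithArrow P lam mu rho f) (hf : P.comp rho f = P.zero c y)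
    (S : Suitable lam mu rho f Fy Th) {F : MorFun P c}
    (hF : F ∈ gen D (gens₀ lam mu f Fy Th t) c) : (F ⟨y, f⟩).2 = t * (F ⟨y, f⟩).1 := by
  refine eq_of_mem_gen (ev₂ f) (t • ev₁ f) ?_ hF
  refine forall_gens₀ (Q := fun g E => ∀ q : P.Hom g c,
    (E ⟨y, P.comp f q⟩).2 = t * (E ⟨y, P.comp f q⟩).1) ?_ ?_ ?_ ?_ <;> intro q
  · simp [S.y_f]
  · rw [B.ex_apply_y S, ind_ne (B.comp_ne_mu_lam hf q)]
    simp
  · rw [ind_ne (B.mu_ne_f_comp q).symm]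
    simp
  · by_cases hq : q = P.id c
    · simp [hq, P.comp_id]
    · rw [ind_ne fun h => hq (B.eq_id_of_f_eq h.symm)]
      simp

theorem gens₀_comp_f (B : DumbBellWithArrow P lam mu rho f) (S : Suitable lam mu rho f Fy Th)
    {F : MorFun P c} (hF : F ∈ gen D (gens₀ lam mu f Fy Th t) c) (p : P.Hom y c) :
    F ⟨c, P.comp p f⟩ = 0 := by
  refine eq_of_mem_gen (LinearMap.proj ⟨c, P.comp p f⟩) 0 ?_ hF
  refine forall_gens₀ (Q := fun g E => ∀ q : P.Hom g c,
    E ⟨c, P.comp (P.comp p f) q⟩ = 0) ?_ ?_ ?_ ?_ <;> intro q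
  · exact S.ne_y _ _ B.c_ne_y
  · rw [B.ex_apply_c, P.assoc]
    exact S.comp_f _ _
  · exact ind_obj_ne B.c_ne_y _ _ _
  · exact ind_obj_ne B.c_ne_y _ _ _

theorem eq_ind_id (B : DumbBellWithArrow P lam mu rho f) (S : Suitable lam mu rho f Fy Th)
    {F : MorFun P y} (hF : F ∈ gen D (gens₀ lam mu f Fy Th t) y)
    (hy : ∀ e, F ⟨y, P.comp e rho⟩ = 0) (hc : ∀ p, F ⟨c, p⟩ = 0) :
    F = ind (P.id y) (F ⟨y, P.id y⟩) := by
  funext ⟨w, p⟩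
  by_cases hwy : w = y
  · subst hwy
    obtain rfl | ⟨e, rfl⟩ := B.hom_yy p
    · rw [ind_self]
    · rw [hy, ind_ne (B.comp_rho_ne e)]
  · rw [ind_obj_ne hwy]
    by_cases hwx : w = x
    · subst hwx
      exact (B.gens₀_vanishing S t).apply_eq_zero hF _ (Or.inl (B.hom_yx p))
    · by_cases hwc : w = c
      · subst hwc
        exact hc p
      · exact gens₀_apply_ne S hwx hwy hwc hF p

theorem shift_mu_lam_gen (B : DumbBellWithArrow P lam mu rho f)
    (S : Suitable lam mu rho f Fy Th) :
    shift (P.comp mu lam) (ind (P.comp mu lam) (0, 1) + ind (P.comp lam lam) (1, 0) + Th) =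
      ind (P.id y) (0, 1) := by
  have h1 : shift (P.comp mu lam) (ind (P.comp lam lam) (1, 0)) = 0 :=
    shift_ind_eq_zero (fun p h => B.lam_lam (by rw [← h, B.hom_yx p, P.zero_comp])) _
  have h2 : shift (P.comp mu lam) Th = 0 := by
    funext ⟨w, p⟩
    rw [shift_apply, ← P.assoc]
    by_cases hw : w = c
    · subst hw
      exact S.comp_lam _
    · exact S.ne_c _ _ hw
  rw [map_add, map_add, shift_ind_self B.mu_lam, h1, h2, add_zero, add_zero]

theorem shift_lam_lam_gen (B : DumbBellWithArrow P lam mu rho f)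
    (S : Suitable lam mu rho f Fy Th) :
    shift (P.comp lam lam) (ind (P.comp mu lam) (0, 1) + ind (P.comp lam lam) (1, 0) + Th) =
      ind (P.id x) (1, 0) := by
  have h1 : shift (P.comp lam lam) (ind (P.comp mu lam) (0, 1)) = 0 := by
    refine shift_ind_eq_zero (fun p h => ?_) _
    obtain rfl | h1 := B.comp_lam_lam_mem p
    · exact B.mu_lam (by rw [← h, P.zero_comp])
    · rw [h] at h1
      exact B.mu_lam_not_mem h1
  have h2 : shift (P.comp lam lam) Th = 0 := by
    funext ⟨w, p⟩
    rw [shift_apply, ← P.assoc]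
    by_cases hw : w = c
    · subst hw
      exact S.comp_lam _
    · exact S.ne_c _ _ hw
  rw [map_add, map_add, shift_ind_self B.lam_lam, h1, h2, add_zero, zero_add]

theorem eq_ind_id_x (B : DumbBellWithArrow P lam mu rho f) (S : Suitable lam mu rho f Fy Th)
    {F : MorFun P x} (hF : F ∈ gen D (gens₀ lam mu f Fy Th t) x) (h : shift mu F = 0) :
    F = (F ⟨x, P.id x⟩).1 • ind (P.id x) (1, 0) := by
  have hmu : ∀ p : P.Hom y y, F ⟨y, P.comp p mu⟩ = 0 := fun p => congrFun h ⟨y, p⟩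
  obtain ⟨h1, h2, h3, h4, h5⟩ := B.gens₀_x S hF
  have h6 := hmu (P.id y)
  rw [P.id_comp] at h6
  rw [B.comm, hmu] at h2
  have h7 : (F ⟨x, P.comp lam lam⟩).1 = 0 := (congrArg Prod.snd h2).symm
  rw [h6] at h1
  rw [h7] at h3
  funext ⟨w, p⟩
  rw [Pi.smul_apply]
  by_cases hwx : w = x
  · subst hwx
    obtain rfl | rfl | ⟨e, rfl⟩ := B.endo_cases_x p
    · simp [Prod.ext_iff, h4]
    · rw [ind_ne]
      · simpa [Prod.ext_iff, h4] using h1.symm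
      · have := B.comp_lam_ne (P.id w)
        rwa [P.id_comp] at this
    · rw [ind_ne (by rw [← P.assoc]; exact B.comp_lam_ne _), smul_zero]
      obtain rfl | ⟨e, rfl⟩ := B.hom_xx e
      · rw [P.id_comp]
        exact Prod.ext h7 (h4 _)
      · have he : P.comp lam (P.comp lam (P.comp lam e)) =
            P.comp (P.comp e lam) (P.comp lam lam) := by
          rw [B.lam_comm e, ← P.assoc lam e lam, B.lam_comm e, ← P.assoc lam _ lam,
            B.lam_comm (P.comp e lam), P.assoc]
        rw [← he]
        exact h5 e
  · rw [ind_obj_ne hwx, smul_zero]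
    by_cases hwy : w = y
    · subst hwy
      obtain rfl | ⟨e, rfl⟩ := B.hom_xy p
      · exact (B.gens₀_vanishing S t).apply_eq_zero hF _ (Or.inl rfl)
      · exact hmu e
    · by_cases hwc : w = c
      · subst hwc
        rw [h3, zero_smul]
      · exact gens₀_apply_ne S hwx hwy hwc hF p

theorem not_repFin_of_suitable (B : DumbBellWithArrow P lam mu rho f)
    (hf : P.comp rho f = P.zero c y) (S : Suitable lam mu rho f Fy Th)
    (hδ : ∀ t, ind (P.id y) (1, 0) ∈ gen {x, y, c} (gens₀ lam mu f Fy Th t) y)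
    (hline : ∀ t t' (φ : RModHom (toRMod (D := {x, y, c}) (B.gens₀_vanishing S t))
      (toRMod (B.gens₀_vanishing S t'))) m, val _ y m = ind (P.id y) (1, 0) →
      ∃ a, val _ y (φ.app y m) = ind (P.id y) (a, 0))
    (hnil : ∀ t (e : RModHom (toRMod (D := {x, y, c}) (B.gens₀_vanishing S t))
      (toRMod (B.gens₀_vanishing S t))), (∀ z, (e.app z).comp (e.app z) = e.app z) →
      (∀ v m, val _ y m = ind (P.id y) v → e.app y m = 0) → ∀ m, e.app y m = 0) :
    ¬ RepFin P {x, y, c} (IdealOf P (P.comp rho (P.comp mu lam))) := by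
  let D : Set P.Obj := {x, y, c}
  have hx : x ∈ D := by simp [D]
  have hy : y ∈ D := by simp [D]
  have hc : c ∈ D := by simp [D]
  have hD : D.Finite := by simp [D]
  let K := B.gens₀_vanishing S
  have hmem : ∀ t v, ind (P.id y) v ∈ gen D (gens₀ lam mu f Fy Th t) y := by
    intro t v
    have h : v = v.1 • ((1, 0) : ℚ × ℚ) + v.2 • ((0, 1) : ℚ × ℚ) := by ext <;> simp
    rw [h, map_add, map_smul, map_smul, ← B.shift_mu_lam_gen S]
    exact add_mem (Submodule.smul_mem _ _ (hδ t))
      (Submodule.smul_mem _ _ (shift_mem_gen hy (mem_gens₀_x t) _))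
  have hsub : ∀ {t : ℚ} (m : (toRMod (D := D) (K t)).M y) (v : ℚ × ℚ) {u : ℚ × ℚ},
      val (K t) y m = ind (P.id y) u → (∃ a : ℚ, a • v = u) →
      ∃ a : ℚ, m - lift (K t) (ind (P.id y)) (hmem t) (a • v) ∈
        (⊥ : Submodule ℚ ((toRMod (D := D) (K t)).M y)) := by
    rintro t m v _ hm ⟨a, rfl⟩
    refine ⟨a, (Submodule.mem_bot ℚ).2 (sub_eq_zero.2 (val_injective (K t) y ?_))⟩
    rw [hm, val_lift]
  refine not_repFin_of_four_lines (fun t => toRMod (D := D) (K t))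
    (fun t => finDim_toRMod _ hD (gens₀_finite t)) y
    (fun t => lift (K t) (ind (P.id y)) (hmem t)) (fun t => ⊥) ?_ ?_ ?_ ?_ ?_ ?_ ?_
  · intro t v hv
    have h := congrArg (val (K t) y) ((Submodule.mem_bot ℚ).1 hv)
    rw [val_lift, map_zero] at h
    have h1 := congrFun h ⟨y, P.id y⟩
    rwa [ind_self] at h1
  · intro t t' φ m hm
    rw [(Submodule.mem_bot ℚ).1 hm, map_zero]
    exact zero_mem _
  · intro t t' φ
    obtain ⟨a, ha⟩ := hline t t' φ (lift (K t) (ind (P.id y)) (hmem t) (1, 0)) (val_lift _ _ _ _)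
    exact hsub _ _ ha ⟨a, by simp⟩
  · intro t t' φ
    obtain ⟨E, hE⟩ := exists_val_eq (D := D) (K t) (mem_gen hx (mem_gens₀_x t))
    have h := val_hom_eq φ hy (P.comp mu lam) (F := E)
      (F' := lift (K t) (ind (P.id y)) (hmem t) (0, 1))
      (by rw [val_lift, hE, B.shift_mu_lam_gen S])
    have hF := val_mem (K t') (φ.app x E)
    obtain ⟨-, h2, h3, -, -⟩ := B.gens₀_x S hF
    have hTh : ∀ p : P.Hom y c, Th ⟨c, P.comp p (P.comp mu lam)⟩ = 0 := fun p => by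
      rw [← P.assoc, S.comp_lam]
    have h4 := B.eq_ind_id S (shift_mem hy (P.comp mu lam) hF)
      (fun e => (K t').apply_eq_zero hF _ (Or.inr ⟨e, P.id x, by rw [P.comp_id, P.assoc]⟩))
      (fun p => (h3 _).trans ((congrArg _ (hTh p)).trans (smul_zero _)))
    refine hsub _ _ (h.trans h4) ⟨(val (K t') x (φ.app x E) ⟨x, P.comp lam lam⟩).1, ?_⟩
    rw [shift_apply, P.id_comp, h2]
    simp
  · intro t t' φ
    obtain ⟨E, hE⟩ := exists_val_eq (D := D) (K t) (mem_gen hx (mem_gens₀_x' t))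
    have h := val_hom_eq φ hy mu (F := E)
      (F' := lift (K t) (ind (P.id y)) (hmem t) (1, 1))
      (by rw [val_lift, hE, shift_ind_self B.irr_mu.1])
    have hl := val_hom_eq φ hx lam (F := E) (F' := 0)
      (by rw [hE, map_zero, shift_ind_eq_zero B.mu_ne_comp_lam])
    rw [map_zero, map_zero] at hl
    have hl' : ∀ {w} (p : P.Hom x w), val (K t') x (φ.app x E) ⟨w, P.comp p lam⟩ = 0 :=
      fun p => (congrFun hl ⟨_, p⟩).symm
    have hF := val_mem (K t') (φ.app x E)
    obtain ⟨h1, -, h3, -, -⟩ := B.gens₀_x S hF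
    have h0 := hl' (P.id x)
    rw [P.id_comp] at h0
    have h4 := B.eq_ind_id S (shift_mem hy mu hF)
      (fun e => by
        have he : P.comp (P.comp e rho) mu = P.comp (P.comp e mu) lam := by
          rw [P.assoc, ← B.comm, P.assoc]
        rw [shift_apply, he]
        exact hl' _)
      (fun p => (h3 _).trans (by rw [hl']; exact zero_smul _ _))
    refine hsub _ _ (h.trans h4) ⟨(val (K t') x (φ.app x E) ⟨y, mu⟩).1, ?_⟩
    rw [shift_apply, P.id_comp]
    simp [Prod.ext_iff, h1, h0]
  · intro t t' φ
    obtain ⟨E, hE⟩ := exists_val_eq (D := D) (K t) (mem_gen hc (mem_gens₀_c t))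
    have h := val_hom_eq φ hy f (F := E)
      (F' := lift (K t) (ind (P.id y)) (hmem t) (1, t))
      (by rw [val_lift, hE, shift_ind_self B.irr_f.1])
    have hF := val_mem (K t') (φ.app c E)
    have h4 := B.eq_ind_id S (shift_mem hy f hF)
      (fun e => (K t').apply_eq_zero hF _ (Or.inl (by rw [P.assoc, hf, P.comp_zero])))
      (fun p => B.gens₀_comp_f S hF p)
    refine hsub _ _ (h.trans h4) ⟨(val (K t') c (φ.app c E) ⟨y, f⟩).1, ?_⟩
    rw [shift_apply, P.id_comp]
    simp [Prod.ext_iff, B.gens₀_c hf S hF, mul_comm]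
  · intro t e he hL
    have he' : ∀ z m, e.app z (e.app z m) = e.app z m := fun z m => LinearMap.congr_fun (he z) m
    have ey : ∀ m, e.app y m = 0 := by
      refine hnil t e he fun v m hm => ?_
      have : m = lift (K t) (ind (P.id y)) (hmem t) v :=
        val_injective (K t) y (hm.trans (val_lift _ _ _ _).symm)
      rw [this]
      exact (Submodule.mem_bot ℚ).1 (hL v)
    have shape_x : ∀ m, val (K t) x (e.app x m) =
        (val (K t) x (e.app x m) ⟨x, P.id x⟩).1 • ind (P.id x) (1, 0) := by
      intro m
      refine B.eq_ind_id_x S (val_mem _ _) ?_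
      rw [← val_hom_act e hy mu m, ey, map_zero]
    have ex : ∀ m, e.app x m = 0 := by
      intro m
      obtain ⟨E, hE⟩ := exists_val_eq (D := D) (K t) (mem_gen hx (mem_gens₀_x t))
      have h := val_hom_eq e hx (P.comp lam lam)
        (F := (val (K t) x (e.app x m) ⟨x, P.id x⟩).1 • E) (F' := e.app x m)
        (by rw [map_smul, map_smul, hE, B.shift_lam_lam_gen S]; exact shape_x m)
      have hz : shift (P.comp lam lam) (ind (P.id x) (1, 0)) = 0 :=
        shift_ind_eq_zero (fun p => by rw [← P.assoc]; exact B.comp_lam_ne _) _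
      rw [he', map_smul, map_smul, map_smul, shape_x E, map_smul, hz, smul_zero, smul_zero] at h
      exact val_injective (K t) x (h.trans (map_zero _).symm)
    obtain ⟨E, hE⟩ := exists_val_eq (D := D) (K t) (mem_gen hc (mem_gens₀_c t))
    have kill : ∀ {a} (ha : a ∈ D) {E : MorFun P a},
        (⟨a, E⟩ : Σ g, MorFun P g) ∈ gens₀ lam mu f Fy Th t → (∀ m, e.app a m = 0) →
        ∀ (q : P.Hom a c) (F : (toRMod (D := D) (K t)).M c), val (K t) c F = shift q E →
        e.app c F = 0 := by
      intro a ha E hEG hE q F hF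
      obtain ⟨E', rfl⟩ := exists_val_eq (D := D) (K t) (mem_gen ha hEG)
      have h := val_hom_eq e hc q hF
      rw [hE, map_zero, map_zero] at h
      exact val_injective (K t) c (h.trans (map_zero _).symm)
    have shape_c : e.app c = ((ev₁ f).comp (val (K t) c)).smulRight (e.app c E) := by
      refine toRMod_hom_ext (forall_gens₀ (Q := fun a E' => ∀ (q : P.Hom a c)
        (F : (toRMod (D := D) (K t)).M c), val (K t) c F = shift q E' →
        e.app c F = (ev₁ f (val (K t) c F)) • e.app c E) ?_ ?_ ?_ ?_) <;> intro q F hF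
      · rw [kill hy (mem_gens₀_y t) ey q F hF, hF, ev₁_apply, shift_apply, S.y_f]
        exact (zero_smul _ _).symm
      · rw [kill hx (mem_gens₀_x t) ex q F hF, hF, ev₁_apply, shift_apply, B.ex_apply_y S,
          ind_snd_fst, zero_smul]
      · rw [kill hx (mem_gens₀_x' t) ex q F hF, hF, ev₁_apply, shift_apply,
          ind_ne (B.mu_ne_f_comp q).symm]
        exact (zero_smul _ _).symm
      · by_cases hq : q = P.id c
        · subst hq
          rw [shift_id] at hF
          rw [hF, val_injective (K t) c (hF.trans hE.symm), ev₁_apply, ind_self, one_smul]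
        · rw [shift_ind_eq_zero (fun p h => hq (B.eq_id_of_f_eq h.symm))] at hF
          rw [hF, val_injective (K t) c (hF.trans (map_zero _).symm), map_zero, map_zero, zero_smul]
    have ec : ∀ m, e.app c m = 0 := by
      have h := congrFun (val_hom_act e hy f E) ⟨y, P.id y⟩
      rw [ey, map_zero, shift_apply, P.id_comp] at h
      have h1 := LinearMap.congr_fun shape_c (e.app c E)
      rw [he', LinearMap.smulRight_apply, LinearMap.comp_apply, ev₁_apply, ← h] at h1
      have h2 : e.app c E = 0 := h1.trans (zero_smul _ _)
      intro m
      rw [shape_c, LinearMap.smulRight_apply, h2, smul_zero]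
    intro z
    by_cases hz : z ∈ D
    · rcases hz with rfl | rfl | rfl
      exacts [LinearMap.ext ex, LinearMap.ext ey, LinearMap.ext ec]
    · exact LinearMap.ext fun m => (toRMod (K t)).supp z hz _

end DumbBellWithArrow

namespace DumbBellWithArrow

open RayCategory MorFun

variable {P : RayCategory} {x y c : P.Obj} {lam : P.Hom x x} {mu : P.Hom x y}
  {rho : P.Hom y y} {f : P.Hom c y} {t : ℚ} {D : Set P.Obj}

theorem rho_ne_zero (B : DumbBellWithArrow P lam mu rho f) : rho ≠ P.zero y y := B.irr_rho.1

theorem suitable_of_forall_ne (B : DumbBellWithArrow P lam mu rho f)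
    (hh : ∀ h, P.comp f h ≠ P.comp rho rho) :
    Suitable lam mu rho f (ind (P.comp rho rho) (1, 0)) 0 where
  vanish_y _ _ hp := ind_eq_zero B.rho_rho (fun h => B.rho_rho (B.ideal_yy h)) hp _
  ne_y _ _ h := ind_obj_ne h _ _ _
  y_f q := ind_ne (hh q) _
  vanish_x _ _ _ := rfl
  ne_c _ _ _ := rfl
  comp_lam _ := rfl
  comp_f _ _ := rfl

theorem gens₀_y_of_forall_ne (B : DumbBellWithArrow P lam mu rho f) {F : MorFun P y}
    (hF : F ∈ gen D (gens₀ lam mu f (ind (P.comp rho rho) (1, 0)) 0 t) y) :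
    (F ⟨y, P.comp rho rho⟩).2 = 0 ∧ (∀ e, F ⟨y, P.comp rho (P.comp rho (P.comp rho e))⟩ = 0) ∧
      ∀ p : P.Hom y c, F ⟨c, p⟩ = 0 := by
  have hx : ∀ p : P.Hom x y, ((ind (P.comp mu lam) (0, 1) + ind (P.comp lam lam) (1, 0) + 0 :
      MorFun P x) ⟨y, p⟩) = ind (P.comp mu lam) (0, 1) ⟨y, p⟩ := fun p => by
    rw [add_zero, Pi.add_apply, ind_obj_ne B.x_ne_y.symm, add_zero]
  have hrr : ∀ q, P.comp rho (P.comp rho q) ≠ P.comp mu lam := fun q h => by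
    rw [B.comm] at h
    exact B.mu_ne_rho_comp q (cancel_left rho h (by rw [h]; exact B.rho_mu)).symm
  refine ⟨?_, fun e => ?_, fun p => ?_⟩
  · refine eq_of_mem_gen (ev₂ (P.comp rho rho)) 0 ?_ hF
    refine forall_gens₀ (Q := fun g E => ∀ q : P.Hom g y,
      (E ⟨y, P.comp (P.comp rho rho) q⟩).2 = 0) ?_ ?_ ?_ ?_ <;> intro q
    · simp
    · rw [hx, P.assoc, ind_ne (hrr q)]
      rfl
    · rw [P.assoc, ind_ne (B.mu_ne_rho_comp _).symm]
      rfl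
    · rw [P.assoc, ind_ne (B.f_ne_rho_comp _).symm]
      rfl
  · refine eq_of_mem_gen (LinearMap.proj ⟨y, P.comp rho (P.comp rho (P.comp rho e))⟩) 0 ?_ hF
    refine forall_gens₀ (Q := fun g E => ∀ q : P.Hom g y,
      E ⟨y, P.comp (P.comp rho (P.comp rho (P.comp rho e))) q⟩ = 0) ?_ ?_ ?_ ?_ <;> intro q <;>
      rw [P.assoc, P.assoc]
    · refine ind_ne (fun h => ?_) _
      have h1 := cancel_left rho h (by rw [h]; exact B.rho_rho)
      rw [P.assoc, B.rho_comm, B.rho_comm, P.assoc] at h1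
      exact B.rho_ne_comp_rho_rho _ h1
    · rw [hx, ind_ne (hrr _)]
    · exact ind_ne (B.mu_ne_rho_comp _).symm _
    · exact ind_ne (B.f_ne_rho_comp _).symm _
  · refine eq_of_mem_gen (LinearMap.proj ⟨c, p⟩) 0 ?_ hF
    refine forall_gens₀ (Q := fun g E => ∀ q : P.Hom g y, E ⟨c, P.comp p q⟩ = 0) ?_ ?_ ?_ ?_ <;>
      intro q
    · exact ind_obj_ne B.c_ne_y _ _ _
    · exact B.ex_apply_c (Th := 0) _
    · exact ind_obj_ne B.c_ne_y _ _ _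
    · exact ind_obj_ne B.c_ne_y _ _ _

theorem shift_rho_rho_eq_of_forall_ne (B : DumbBellWithArrow P lam mu rho f)
    (hh : ∀ h, P.comp f h ≠ P.comp rho rho) {F : MorFun P y}
    (hF : F ∈ gen {x, y, c} (gens₀ lam mu f (ind (P.comp rho rho) (1, 0)) 0 t) y) :
    shift (P.comp rho rho) F = ind (P.id y) ((F ⟨y, P.comp rho rho⟩).1, 0) := by
  obtain ⟨h1, h2, h3⟩ := B.gens₀_y_of_forall_ne hF
  have h := B.eq_ind_id (B.suitable_of_forall_ne hh) (shift_mem (by simp) (P.comp rho rho) hF)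
    (fun e => by rw [shift_apply, B.comp_rho_rho, ← B.rho_comm]; exact h2 e)
    (fun p => h3 _)
  rw [shift_apply, P.id_comp] at h
  rw [h, ← h1]

theorem not_repFin_of_forall_ne (B : DumbBellWithArrow P lam mu rho f)
    (hf : P.comp rho f = P.zero c y) (hh : ∀ h, P.comp f h ≠ P.comp rho rho) :
    ¬ RepFin P {x, y, c} (IdealOf P (P.comp rho (P.comp mu lam))) := by
  have S := B.suitable_of_forall_ne hh
  have hy : y ∈ ({x, y, c} : Set P.Obj) := by simp
  refine B.not_repFin_of_suitable hf S (fun t => ?_) (fun t t' φ m hm => ?_)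
    (fun t e he hL m => ?_)
  · rw [← shift_ind_self B.rho_rho]
    exact shift_mem_gen hy (mem_gens₀_y t) _
  · obtain ⟨E, hE⟩ := exists_val_eq (B.gens₀_vanishing S t) (mem_gen hy (mem_gens₀_y t))
    have h := val_hom_eq φ hy (P.comp rho rho) (F := E) (F' := m)
      (by rw [hm, hE, shift_ind_self B.rho_rho])
    exact ⟨_, h.trans (B.shift_rho_rho_eq_of_forall_ne hh (val_mem _ _))⟩
  · let K := B.gens₀_vanishing S t
    have he' : ∀ m, e.app y (e.app y m) = e.app y m := fun m => LinearMap.congr_fun (he y) m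
    have hker : ∀ (q : P.Hom y y) m, e.app y ((toRMod (D := {x, y, c}) K).act q m) = 0 →
        shift q (val K y (e.app y m)) = 0 := fun q m h => by
      rw [← val_hom_act e hy, h, map_zero]
    have h1 : ∀ m, shift rho (val K y m) = 0 → e.app y m = 0 := fun m h =>
      hL _ m (B.eq_ind_id S (val_mem K m) (fun e => congrFun h ⟨y, e⟩)
        (B.gens₀_y_of_forall_ne (val_mem K m)).2.2)
    have h2 : ∀ m, shift (P.comp rho rho) (val K y m) = 0 → e.app y m = 0 := fun m h => by
      rw [← he']
      refine h1 _ (hker rho m (h1 _ ?_))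
      rw [val_act K hy, ← shift_comp, h]
    rw [← he']
    refine h2 _ (hker _ m (hL _ _ ((val_act K hy _ _).trans
      (B.shift_rho_rho_eq_of_forall_ne hh (val_mem K m)))))

variable {h : P.Hom y c}

theorem f_comp_f (B : DumbBellWithArrow P lam mu rho f) (hf : P.comp rho f = P.zero c y)
    (p : P.Hom y c) : P.comp f (P.comp p f) = P.zero c y := by
  rw [← P.assoc]
  obtain h | ⟨e, h⟩ := B.hom_yy (P.comp f p)
  · exact absurd h (B.id_ne_f_comp p)
  · rw [h, P.assoc, hf, P.comp_zero]

theorem comp_comp_mu (hh : P.comp f h = P.comp rho rho) :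
    P.comp f (P.comp h mu) = P.comp rho (P.comp rho mu) := by
  rw [← P.assoc, hh, P.assoc]

theorem suitable_of_eq (B : DumbBellWithArrow P lam mu rho f) (hf : P.comp rho f = P.zero c y)
    (hh : P.comp f h = P.comp rho rho) :
    Suitable lam mu rho f (ind rho (1, 0)) (ind (P.comp h mu) (1, 0)) where
  vanish_y _ _ hp := ind_eq_zero B.rho_ne_zero (fun h => B.rho_ne_zero (B.ideal_yy h)) hp _
  ne_y _ _ h := ind_obj_ne h _ _ _
  y_f q := ind_ne (B.rho_ne_comp q).symm _
  vanish_x _ _ hp := by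
    refine ind_eq_zero (fun h0 => B.rho_rho_mu ?_) (fun h0 => B.rho_rho_mu ?_) hp _
    · rw [← comp_comp_mu hh, h0, P.comp_zero]
    · obtain ⟨g, m, hg⟩ := h0
      rw [← comp_comp_mu hh, hg, P.assoc rho, ← P.assoc g, ← P.assoc f, ← P.assoc f, ← B.rho_comm,
        ← P.assoc rho f, hf, P.zero_comp, P.zero_comp]
  ne_c _ _ h := ind_obj_ne h _ _ _
  comp_lam p := by
    refine ind_ne (fun hp => B.comp_ne_mu_lam hf p ?_) _
    have h1 : P.comp (P.comp f p) lam = P.comp (P.comp mu lam) lam := by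
      rw [P.assoc, hp, comp_comp_mu hh, B.comm, P.assoc, B.comm]
    refine cancel_right lam h1 ?_
    rw [P.assoc, hp, comp_comp_mu hh]
    exact B.rho_rho_mu
  comp_f p b := by
    refine ind_ne (fun hp => B.rho_rho_mu ?_) _
    rw [← comp_comp_mu hh, ← hp, ← P.assoc p, ← P.assoc f, B.f_comp_f hf, P.zero_comp]

theorem gens₀_y_of_eq (B : DumbBellWithArrow P lam mu rho f) (hf : P.comp rho f = P.zero c y)
    (hh : P.comp f h = P.comp rho rho) {F : MorFun P y}
    (hF : F ∈ gen D (gens₀ lam mu f (ind rho (1, 0)) (ind (P.comp h mu) (1, 0)) t) y) :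
    F ⟨c, h⟩ = ((F ⟨y, rho⟩).2, 0) ∧ (∀ p, p ≠ h → F ⟨c, p⟩ = 0) ∧
      ∀ e, F ⟨y, P.comp e (P.comp rho rho)⟩ = 0 := by
  have S := B.suitable_of_eq hf hh
  have hv := B.gens₀_vanishing S t
  have hcomm : ∀ e q : P.Hom y y, P.comp (P.comp e (P.comp rho rho)) q =
      P.comp (P.comp e q) (P.comp rho rho) := fun e q => by
    rw [P.assoc e _ q, P.assoc rho rho q, ← B.comp_rho_rho q, ← P.assoc]
  have hmem : ∀ e e' : P.Hom y y, IdealOf P (P.comp rho (P.comp mu lam)) x y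
      (P.comp (P.comp e (P.comp rho rho)) (P.comp e' mu)) := fun e e' => by
    have h1 : P.comp (P.comp e (P.comp rho rho)) (P.comp e' mu) =
        P.comp (P.comp e e') (P.comp rho (P.comp rho mu)) := by
      rw [← P.assoc _ e' mu, hcomm]
      simp only [P.assoc]
    rw [h1]
    exact B.rho_rho_mu_mem _
  have hrho : ∀ e : P.Hom y y, P.comp (P.comp e rho) mu = P.comp (P.comp e mu) lam := fun e => by
    rw [P.assoc, ← B.comm, P.assoc]
  refine ⟨?_, fun p hp => ?_, fun e => ?_⟩
  · refine eq_of_mem_gen (LinearMap.proj ⟨c, h⟩) ((LinearMap.inl ℚ ℚ ℚ).comp (ev₂ rho)) ?_ hF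
    refine forall_gens₀ (Q := fun g E => ∀ q : P.Hom g y,
      E ⟨c, P.comp h q⟩ = ((E ⟨y, P.comp rho q⟩).2, 0)) ?_ ?_ ?_ ?_ <;> intro q
    · rw [ind_obj_ne B.c_ne_y, ind_fst_snd]
      rfl
    · rw [B.ex_apply_c, B.ex_apply_y S]
      obtain rfl | ⟨e, rfl⟩ := B.hom_xy q
      · rw [P.comp_zero, P.comp_zero, S.vanish_x _ _ (Or.inl rfl), ind_ne B.mu_lam.symm]
        rfl
      · obtain rfl | ⟨e, rfl⟩ := B.hom_yy e
        · rw [P.id_comp, ← B.comm, ind_self, ind_self]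
        · rw [hrho, ← P.assoc, S.comp_lam, ind_ne fun h0 => ?_]
          · rfl
          · rw [← P.assoc] at h0
            exact B.mu_ne_rho_comp _ (cancel_right lam h0 (by rw [h0]; exact B.mu_lam)).symm
    · rw [ind_obj_ne B.c_ne_y, ind_ne (B.mu_ne_rho_comp _).symm]
      rfl
    · rw [ind_obj_ne B.c_ne_y, ind_ne (B.f_ne_rho_comp _).symm]
      rfl
  · refine eq_of_mem_gen (LinearMap.proj ⟨c, p⟩) 0 ?_ hF
    refine forall_gens₀ (Q := fun g E => ∀ q : P.Hom g y, E ⟨c, P.comp p q⟩ = 0) ?_ ?_ ?_ ?_ <;>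
      intro q
    · exact ind_obj_ne B.c_ne_y _ _ _
    · rw [B.ex_apply_c]
      obtain rfl | ⟨e, rfl⟩ := B.hom_xy q
      · exact S.vanish_x _ _ (Or.inl (P.comp_zero _))
      · obtain rfl | ⟨e, rfl⟩ := B.hom_yy e
        · rw [P.id_comp]
          refine ind_ne (fun h0 => hp (cancel_right mu h0 fun h1 => B.rho_rho_mu ?_)) _
          rw [← comp_comp_mu hh, ← h0, h1, P.comp_zero]
        · rw [hrho, ← P.assoc, S.comp_lam]
    · exact ind_obj_ne B.c_ne_y _ _ _
    · exact ind_obj_ne B.c_ne_y _ _ _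
  · refine eq_of_mem_gen (LinearMap.proj ⟨y, P.comp e (P.comp rho rho)⟩) 0 ?_ hF
    refine forall_gens₀ (Q := fun g E => ∀ q : P.Hom g y,
      E ⟨y, P.comp (P.comp e (P.comp rho rho)) q⟩ = 0) ?_ ?_ ?_ ?_ <;> intro q
    · exact ind_ne (fun h0 => B.rho_ne_comp_rho_rho (P.comp e q) ((hcomm e q).symm.trans h0)) _
    · refine hv _ (mem_gens₀_x t) _ _ ?_
      obtain rfl | ⟨e', rfl⟩ := B.hom_xy q
      · exact Or.inl (P.comp_zero _)
      · exact Or.inr (hmem e e')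
    · rw [B.comp_rho_rho, P.assoc, ind_ne (B.mu_ne_rho_comp _).symm]
    · rw [B.comp_rho_rho, P.assoc, ind_ne (B.f_ne_rho_comp _).symm]

theorem shift_rho_eq_of_eq (B : DumbBellWithArrow P lam mu rho f)
    (hf : P.comp rho f = P.zero c y) (hh : P.comp f h = P.comp rho rho) {F : MorFun P y}
    (hF : F ∈ gen {x, y, c} (gens₀ lam mu f (ind rho (1, 0)) (ind (P.comp h mu) (1, 0)) t) y) :
    shift rho F = ind (P.id y) (F ⟨y, rho⟩) := by
  obtain ⟨-, h2, h3⟩ := B.gens₀_y_of_eq hf hh hF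
  have h4 := B.eq_ind_id (B.suitable_of_eq hf hh) (shift_mem (by simp) rho hF)
    (fun e => by rw [shift_apply, P.assoc]; exact h3 e)
    (fun p => h2 _ fun h0 => by
      have h1 : P.comp (P.comp f p) rho = P.comp rho rho := by rw [P.assoc, h0, hh]
      exact B.rho_ne_comp p (cancel_right rho h1 (by rw [h1]; exact B.rho_rho)).symm)
  rwa [shift_apply, P.id_comp] at h4

theorem not_repFin_of_eq (B : DumbBellWithArrow P lam mu rho f)
    (hf : P.comp rho f = P.zero c y) (hh : P.comp f h = P.comp rho rho) :
    ¬ RepFin P {x, y, c} (IdealOf P (P.comp rho (P.comp mu lam))) := by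
  have S := B.suitable_of_eq hf hh
  have hy : y ∈ ({x, y, c} : Set P.Obj) := by simp
  have hc : c ∈ ({x, y, c} : Set P.Obj) := by simp
  refine B.not_repFin_of_suitable hf S (fun t => ?_) (fun t t' φ m hm => ?_)
    (fun t e he hL m => ?_)
  · rw [← shift_ind_self B.rho_ne_zero]
    exact shift_mem_gen hy (mem_gens₀_y t) _
  · obtain ⟨E, hE⟩ := exists_val_eq (B.gens₀_vanishing S t) (mem_gen hy (mem_gens₀_y t))
    have h1 := val_hom_eq φ hy rho (F := E) (F' := m)
      (by rw [hm, hE, shift_ind_self B.rho_ne_zero])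
    have h2 := val_hom_eq φ hc h (F := E) (F' := 0)
      (by rw [hE, map_zero, shift_ind_eq_zero fun p => (B.rho_ne_comp h).symm])
    rw [map_zero, map_zero] at h2
    have h3 := congrFun h2 ⟨c, P.id c⟩
    have hF := val_mem (B.gens₀_vanishing S t') (φ.app y E)
    rw [shift_apply, P.id_comp, (B.gens₀_y_of_eq hf hh hF).1] at h3
    exact ⟨_, (h1.trans (B.shift_rho_eq_of_eq hf hh hF)).trans
      (congrArg (ind (P.id y)) (Prod.ext rfl (congrArg Prod.fst h3).symm))⟩
  · let K := B.gens₀_vanishing S t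
    have he' : e.app y (e.app y m) = e.app y m := LinearMap.congr_fun (he y) m
    have h1 : shift rho (val K y (e.app y m)) = 0 := by
      rw [← val_hom_act e hy, hL _ _ ((val_act K hy _ _).trans
        (B.shift_rho_eq_of_eq hf hh (val_mem K m))), map_zero]
    have h2 : ∀ q, val K y (e.app y m) ⟨y, P.comp q rho⟩ = 0 := fun q => congrFun h1 ⟨y, q⟩
    have h3 := h2 (P.id y)
    rw [P.id_comp] at h3
    obtain ⟨h4, h5, -⟩ := B.gens₀_y_of_eq hf hh (val_mem K (e.app y m))
    rw [h3] at h4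
    rw [← he']
    refine hL _ _ (B.eq_ind_id S (val_mem K (e.app y m)) h2 fun p => ?_)
    by_cases hp : p = h
    · rw [hp, h4]
      rfl
    · exact h5 p hp

theorem not_repFin (B : DumbBellWithArrow P lam mu rho f) :
    ¬ RepFin P {x, y, c} (IdealOf P (P.comp rho (P.comp mu lam))) := by
  by_cases hf : P.comp rho f = P.zero c y
  · by_cases hh : ∃ h, P.comp f h = P.comp rho rho
    · obtain ⟨h, hh⟩ := hh
      exact B.not_repFin_of_eq hf hh
    · exact B.not_repFin_of_forall_ne hf fun h hh' => hh ⟨h, hh'⟩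
  · exact B.not_repFin_of_comp_ne hf

end DumbBellWithArrow

namespace DumbBellData

open RayCategory

variable {P : RayCategory} {x y c : P.Obj} {lam : P.Hom x x} {mu : P.Hom x y} {rho : P.Hom y y}
  {r s : ℕ} {f : P.Hom c y}

/-- An arrow ending at `y` and starting outside a dumb-bell. -/
theorem withArrow (h : DumbBellData P x y lam mu rho r s) (hm : P.IsIrreducible mu)
    (hl : P.IsIrreducible lam) (hr : P.IsIrreducible rho) (hf : P.IsIrreducible f)
    (hcx : c ≠ x) (hcy : c ≠ y) : DumbBellWithArrow P lam mu rho f := by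
  obtain ⟨hxy, -, -, -, -, hcomm, hlr, hrs, hlr', hrs', hmin, -, hxx, hyy, hmu, hne, hyx⟩ := h
  have hr3 : 3 ≤ r := hmin ▸ min_le_left r s
  have hs3 : 3 ≤ s := hmin ▸ min_le_right r s
  have hpow : ∀ {z : P.Obj} {g : P.Hom z z}, (∀ e : P.Hom z z, ∃ i, e = P.pow g i) →
      ∀ e, P.comp g e = P.comp e g := fun hg e => by
    obtain ⟨i, rfl⟩ := hg e
    exact pow_succ_comm _ i
  have hid : ∀ {z : P.Obj} {g : P.Hom z z}, (∀ e : P.Hom z z, ∃ i, e = P.pow g i) →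
      ∀ e, e = P.id z ∨ ∃ e', e = P.comp e' g := fun hg e => by
    obtain ⟨_ | i, rfl⟩ := hg e
    · exact Or.inl rfl
    · exact Or.inr ⟨_, pow_succ_comm _ i⟩
  have hsq : ∀ {z : P.Obj} {g : P.Hom z z} {n : ℕ}, 3 ≤ n → P.pow g (n - 1) ≠ P.zero z z →
      P.comp g g ≠ P.zero z z := fun {z g n} hn h h0 => by
    refine h (pow_eq_zero_of_le g (m := 2) (by omega) ?_)
    rw [pow, pow, pow, P.comp_id, h0]
  have hmupow : ∀ i, P.comp mu (P.pow lam i) = P.comp (P.pow rho i) mu := fun i => by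
    induction i with
    | zero => rw [pow, pow, P.comp_id, P.id_comp]
    | succ i ih => rw [pow, ← P.assoc, hcomm, P.assoc, ih, pow, P.assoc]
  refine ⟨hxy, hcx, hcy, hm, hr, hf, hcomm, hid hxx, hid hyy, hpow hxx, hpow hyy, fun p => ?_, hyx,
    fun e => ?_, fun e => ?_, hsq hr3 hlr', hsq hs3 hrs', ?_⟩
  · obtain h | ⟨i, rfl⟩ := hmu p
    exacts [Or.inl h, Or.inr ⟨_, hmupow i⟩]
  · rw [← hpow hxx]
    exact comp_ne_id_of_nilpotent hlr hl.1 e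
  · rw [← hpow hyy]
    exact comp_ne_id_of_nilpotent hrs hr.1 e
  · have h2 := hne 2 (by omega)
    rwa [hmupow, pow, pow, pow, P.comp_id, P.assoc] at h2

theorem eq_of_isIrreducible_xy (h : DumbBellData P x y lam mu rho r s) {g : P.Hom x y}
    (hg : P.IsIrreducible g) : g = mu :=  by
  obtain ⟨hxy, hl, -, -, -, -, hlr, -, -, -, -, -, -, -, hmu, -, -⟩ := h
  obtain h0 | ⟨_ | i, hi⟩ := hmu g
  · exact absurd h0 hg.1
  · rw [hi, pow, P.comp_id]
  · rcases hg.2.2 _ _ _ hi with h1 | h1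
    · exact absurd h1.obj_eq hxy
    · exact absurd h1.eq_id (comp_ne_id_of_nilpotent hlr hl.1 _)

end DumbBellData

/-- **Lemma 3.1.** Let `C` be a mild contour which is a dumb-bell with points `x`, `y`,
loops `λ` at `x` and `ρ` at `y` and arrow `μ : x → y`.  Then `μ` and `ρ` are the only
arrows of `P` ending at `y`. -/
theorem dumbbell_arrows_ending_at_y (P : RayCategory) {x y : P.Obj} (C : Contour P x y)
    (hM : C.Mild)
    (lam : P.Hom x x) (mu : P.Hom x y) (rho : P.Hom y y) (r s : ℕ)
    (hDB : DumbBellData P x y lam mu rho r s)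
    (hl : P.IsIrreducible lam) (hm : P.IsIrreducible mu) (hr : P.IsIrreducible rho)
    (hv : C.v = RPath.cons mu hm (RPath.cons lam hl (RPath.nil x)))
    (hw : C.w = RPath.cons rho hr (RPath.cons mu hm (RPath.nil x))) :
    ∀ (c : P.Obj) (f : P.Hom c y), P.IsIrreducible f → HEq f mu ∨ HEq f rho := by
  intro c f hf
  by_cases hcx : c = x
  · subst hcx
    exact Or.inl (heq_of_eq (hDB.eq_of_isIrreducible_xy hf))
  by_cases hcy : c = y
  · subst hcy
    exact Or.inr (heq_of_eq ((RayCategory.pi_eq_of_isIrreducible hf).symm.trans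
      (RayCategory.pi_eq_of_isIrreducible hr)))
  have B := hDB.withArrow hm hl hr hf hcx hcy
  have hC : C.v.toHom = P.comp mu lam := by
    simp only [hv, RPath.toHom, P.comp_id]
  have hIt : C.It = IdealOf P (P.comp rho (P.comp mu lam)) := by
    rw [Contour.It, hC, RayCategory.pi_eq_of_isIrreducible hr]
  have hIc : C.Ic = IdealOf P (P.comp rho (P.comp mu lam)) := by
    rw [Contour.Ic, hC, RayCategory.pi_eq_of_isIrreducible hl, ← P.assoc, ← B.comm]
  have hD : ({x, y, c} : Set P.Obj) ⊆
      ProjSupp P (IdealOf P (P.comp rho (P.comp mu lam))) x ∪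
        InjSupp P (IdealOf P (P.comp rho (P.comp mu lam))) y := by
    rintro z (rfl | rfl | rfl)
    · exact Or.inr ⟨mu, hm.1, B.mu_not_mem⟩
    · exact Or.inl ⟨mu, hm.1, B.mu_not_mem⟩
    · exact Or.inr ⟨f, hf.1, B.f_not_mem⟩
  have hfin : ({x, y, c} : Set P.Obj).Finite := by simp
  have hcard : ({x, y, c} : Set P.Obj).ncard ≤ 4 := by
    have h1 := Set.ncard_insert_le x ({y, c} : Set P.Obj)
    have h2 := Set.ncard_insert_le y ({c} : Set P.Obj)
    rw [Set.ncard_singleton] at h2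
    omega
  refine absurd ?_ B.not_repFin
  rcases hM with ⟨-, -, hM⟩ | ⟨-, -, hM⟩
  · rw [← hIt]
    exact hM _ ⟨by simp, by simp, by rwa [hIt]⟩ hfin hcard
  · rw [← hIc]
    exact hM _ ⟨by simp, by simp, by rwa [hIc]⟩ hfin hcard
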